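/- Let b be a prime and let t, p with 1 ≤ p < ∞ and t ∈ ℕ₀ be given. There exists a constant C_{p,t} > 0, depending only on p and t, such that for every m ∈ ℕ with t ≤ 2m and every two-dimensional digital net P over ℤ_b consisting of b^m points whose minimum Dick weight satisfies ρ₂(P) > 2m − t, the L_p discrepancy of π(P) ⊂ [0,1]² satisfies L_p(π(P)) ≤ C_{p,t} · √m / b^m. -/

import Mathlib

open MeasureTheory

noncomputable section

namespace Sym

/-! ### The group `G = (ℤ_b)^ℕ` and its normalized Haar (= product) measure -/

instance (b : ℕ) : TopologicalSpace (ZMod b) := ⊥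
instance (b : ℕ) : DiscreteTopology (ZMod b) := ⟨rfl⟩
instance (b : ℕ) : MeasurableSpace (ZMod b) := ⊤
instance (b : ℕ) : BorelSpace (ZMod b) :=
  ⟨(borel_eq_top_of_discrete (α := ZMod b)).symm⟩

/-- `G = (ℤ_b)^ℕ`, the compact totally disconnected abelian group of `ℤ_b`-valued
sequences with componentwise addition modulo `b`. -/
abbrev G (b : ℕ) := ℕ → ZMod b

/-- The product measure `ν` on `G`, realized as the normalized Haar measure of the
compact group `G` (which is the product of the uniform probability measures on `ℤ_b`). -/
def nu (b : ℕ) [NeZero b] : Measure (G b) :=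
  Measure.addHaarMeasure (⊤ : TopologicalSpace.PositiveCompacts (G b))

/-- The product measure on `G^s`. -/
def nuS (b : ℕ) [NeZero b] (s : ℕ) : Measure (Fin s → G b) :=
  Measure.pi fun _ : Fin s => nu b

/-! ### b-adic digits, characters, projection, section, Walsh functions -/

/-- the `i`-th `b`-adic digit of `k` (`i = 0,1,2,...`). -/
def dgt (b k i : ℕ) : ℕ := k / b ^ i % b

/-- the `i`-th `b`-adic digit of `k`, as an element of `ℤ_b`. -/
def zdgt (b k i : ℕ) : ZMod b := (dgt b k i : ZMod b)

/-- the `b`-adic digit sum `δ(k)` of `k`. -/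
def dsum (b k : ℕ) : ℕ := ∑ i ∈ Finset.range k, dgt b k i

/-- `k ∈ 𝓔`, i.e. the `b`-adic digit sum of `k` is `≡ 0 (mod b)`. -/
def inE (b k : ℕ) : Prop := dsum b k % b = 0

/-- The `k`-th character `W_k : G → ℂ`,
`W_k(z) = ω^(κ₀ζ₁ + ⋯ + κ_{a-1}ζ_a)` with `ω = exp(2π√-1/b)`. -/
def W (b k : ℕ) (z : G b) : ℂ :=
  Complex.exp (2 * Real.pi * Complex.I *
    (∑ i ∈ Finset.range k, (dgt b k i : ℝ) * ((z i).val : ℝ)) / b)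

/-- The `k`-th character on `G^s`. -/
def WS (b s : ℕ) (k : Fin s → ℕ) (z : Fin s → G b) : ℂ :=
  ∏ j, W b (k j) (z j)

/-- The projection `π : G → [0,1]`, `π(z) = ∑_{i≥1} ζ_i b^{-i}`. -/
def projG (b : ℕ) (z : G b) : ℝ := ∑' i : ℕ, ((z i).val : ℝ) / b ^ (i + 1)

/-- The componentwise projection `π : G^s → [0,1]^s`. -/
def projS (b s : ℕ) (z : Fin s → G b) : Fin s → ℝ := fun j => projG b (z j)

/-- The section `σ : [0,1] → G`, sending `x` to the digits of its unique `b`-adic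
expansion with infinitely many digits `≠ b-1` (all digits `b-1` for `x = 1`). -/
def secG (b : ℕ) (x : ℝ) : G b := fun i =>
  if x = 1 then (-1 : ZMod b) else ((⌊x * (b : ℝ) ^ (i + 1)⌋ : ℤ) : ZMod b)

/-- The componentwise section `σ : [0,1]^s → G^s`. -/
def secS (b s : ℕ) (x : Fin s → ℝ) : Fin s → G b := fun j => secG b (x j)

/-- The unit cube `[0,1]^s`. -/
def cube (s : ℕ) : Set (Fin s → ℝ) := Set.Icc 0 1

/-- The `k`-th `b`-adic Walsh function on `[0,1]^s`, `wal_k(x) = W_k(σ(x))`. -/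
def walS (b s : ℕ) (k : Fin s → ℕ) (x : Fin s → ℝ) : ℂ := WS b s k (secS b s x)

/-- The `(k,l)`-th Walsh coefficient of a kernel `K`. -/
def Khat (b s : ℕ) (K : (Fin s → ℝ) → (Fin s → ℝ) → ℝ) (k l : Fin s → ℕ) : ℂ :=
  ∫ x in cube s, ∫ y in cube s,
    (K x y : ℂ) * (starRingEnd ℂ) (walS b s k x) * walS b s l y

/-! ### Digital nets -/

/-- The point `z_n` of the digital net with generating matrices `C₁,…,C_s ∈ ℤ_b^{ℕ×m}`:
its `j`-th component is `(ν₀,…,ν_{m-1})·C_j^⊤ ∈ G` where `n = ∑ ν_i b^i`. -/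
def netPt (b m s : ℕ) (C : Fin s → ℕ → Fin m → ZMod b) (n : ℕ) : Fin s → G b :=
  fun j i => ∑ t : Fin m, zdgt b n t * C j i t

/-- The digital net over `ℤ_b` in `G^s` with generating matrices `C₁,…,C_s`, as a
multiset (points counted with multiplicity). -/
def netMS (b m s : ℕ) (C : Fin s → ℕ → Fin m → ZMod b) : Multiset (Fin s → G b) :=
  (Multiset.range (b ^ m)).map (netPt b m s C)

/-- membership in the dual net: `k⃗₁C₁ ⊕ ⋯ ⊕ k⃗_sC_s = 0 ∈ ℤ_b^m`. -/
def inDual (b m s : ℕ) (C : Fin s → ℕ → Fin m → ZMod b) (k : Fin s → ℕ) : Prop :=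
  ∀ t : Fin m, ∑ j, ∑ i ∈ Finset.range (k j), zdgt b (k j) i * C j i t = 0

/-- `e_l = (e_{l₁},…,e_{l_s}) ∈ G^s` where `e_{l_j} = (l_j, l_j, …) ∈ G`. -/
def ept (b s : ℕ) (l : Fin s → ZMod b) : Fin s → G b := fun j _ => l j

/-- The symmetrized point set `𝒫^sym = {z ⊕ e_l : z ∈ 𝒫, l ∈ ℤ_b^s}` of a multiset
`𝒫 ⊂ G^s`. -/
def symMS (b s : ℕ) [NeZero b] (P : Multiset (Fin s → G b)) : Multiset (Fin s → G b) :=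
  P.bind fun z => (Finset.univ : Finset (Fin s → ZMod b)).val.map fun l => z + ept b s l

/-- The generating matrices `D_j = (C_j, E_j)` of the symmetrized digital net, where the
`j`-th column of `E_j ∈ ℤ_b^{ℕ×s}` is all ones and its other entries vanish. -/
def symMat (b m s : ℕ) (C : Fin s → ℕ → Fin m → ZMod b) (j : Fin s) (i : ℕ)
    (t : Fin (m + s)) : ZMod b :=
  if h : (t : ℕ) < m then C j i ⟨t, h⟩ else if (t : ℕ) = m + j then 1 else 0

/-- The symmetrized digital net `π(𝒫^sym) ⊂ [0,1]^s` of the digital net with generating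
matrices `C₁,…,C_s`, as a multiset of points of `[0,1]^s`. -/
def symNetPts (b m s : ℕ) [NeZero b] (C : Fin s → ℕ → Fin m → ZMod b) :
    Multiset (Fin s → ℝ) :=
  (symMS b s (netMS b m s C)).map (projS b s)

/-! ### Worst-case error, digital shift -/

/-- The squared worst-case error
`e²(P,K) = ∫∫K − (2/|P|) ∑_{x∈P} ∫ K(x,y)dy + (1/|P|²) ∑_{x,y∈P} K(x,y)`. -/
def sqErr (s : ℕ) (P : Multiset (Fin s → ℝ)) (K : (Fin s → ℝ) → (Fin s → ℝ) → ℝ) : ℝ :=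
  (∫ x in cube s, ∫ y in cube s, K x y)
    - 2 / (P.card : ℝ) * (P.map fun x => ∫ y in cube s, K x y).sum
    + 1 / (P.card : ℝ) ^ 2 * (P.map fun x => (P.map fun y => K x y).sum).sum

/-- The `b`-adic digital shift `x ⊕ y := π(σ(x) ⊕ σ(y))` on `[0,1]^s`. -/
def dshiftS (b s : ℕ) (x y : Fin s → ℝ) : Fin s → ℝ :=
  fun j => projG b (secG b (x j) + secG b (y j))

/-- The digital shift invariant kernel `K_ds(x,y) = ∫_{[0,1]^s} K(x⊕σ̃, y⊕σ̃) dσ̃`. -/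
def Kds (b s : ℕ) (K : (Fin s → ℝ) → (Fin s → ℝ) → ℝ) (x y : Fin s → ℝ) : ℝ :=
  ∫ t in cube s, K (dshiftS b s x t) (dshiftS b s y t)

/-! ### Two-dimensional discrepancy and the Dick weight -/

/-- The local discrepancy `Δ(t;P)` of a finite multiset `P ⊂ [0,1]²`. -/
def disc2 (P : Multiset (ℝ × ℝ)) (t : ℝ × ℝ) : ℝ :=
  (P.map fun x => if 0 ≤ x.1 ∧ x.1 < t.1 ∧ 0 ≤ x.2 ∧ x.2 < t.2 then (1 : ℝ) else 0).sum
      / (P.card : ℝ)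
    - t.1 * t.2

/-- The `L_p` discrepancy of a finite multiset `P ⊂ [0,1]²`. -/
def LpDisc (p : ℝ) (P : Multiset (ℝ × ℝ)) : ℝ :=
  (∫ t in Set.Icc ((0 : ℝ), (0 : ℝ)) (1, 1), |disc2 P t| ^ p) ^ (1 / p)

/-- The Dick weight `μ₂(k) = a₁ + a₂` (resp. `a₁`, `0`), where `a₁ > a₂` are the positions
of the two highest nonzero `b`-adic digits of `k`. -/
def mu2 (b k : ℕ) : ℕ :=
  if k = 0 then 0
  else Nat.log b k + 1 +
    (if k % b ^ Nat.log b k = 0 then 0 else Nat.log b (k % b ^ Nat.log b k) + 1)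

end Sym

open MeasureTheory Sym

open scoped Classical

noncomputable section

namespace Sym

/-- The two-dimensional symmetrized Hammersley point set in base `b` with `b^{m+2}`
points `(x_a, y_a)`, `a = (a₁,…,a_{m+2}) ∈ {0,…,b-1}^{m+2}`. -/
def hamSymPts (b m : ℕ) [NeZero b] : Multiset (ℝ × ℝ) :=
  (Finset.univ : Finset (Fin (m + 2) → ZMod b)).val.map fun a =>
    (∑ i : Fin m,
        ((a (Fin.castLE (by omega) i) + a ⟨m, by omega⟩).val : ℝ) / (b : ℝ) ^ ((i : ℕ) + 1)
       + ((a ⟨m, by omega⟩).val : ℝ) / ((b : ℝ) ^ m * ((b : ℝ) - 1)),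
     ∑ i : Fin m,
        ((a ⟨m - 1 - (i : ℕ), by omega⟩ + a ⟨m + 1, by omega⟩).val : ℝ) / (b : ℝ) ^ ((i : ℕ) + 1)
       + ((a ⟨m + 1, by omega⟩).val : ℝ) / ((b : ℝ) ^ m * ((b : ℝ) - 1)))

/-- The truncated two-dimensional symmetrized Hammersley point set `P_H^{sym,n}`. -/
def hamSymPtsTrunc (b m n : ℕ) [NeZero b] : Multiset (ℝ × ℝ) :=
  (Finset.univ : Finset (Fin (m + 2) → ZMod b)).val.map fun a =>
    (∑ i : Fin m,
        ((a (Fin.castLE (by omega) i) + a ⟨m, by omega⟩).val : ℝ) / (b : ℝ) ^ ((i : ℕ) + 1)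
       + ∑ i ∈ Finset.Icc (m + 1) n, ((a ⟨m, by omega⟩).val : ℝ) / (b : ℝ) ^ i,
     ∑ i : Fin m,
        ((a ⟨m - 1 - (i : ℕ), by omega⟩ + a ⟨m + 1, by omega⟩).val : ℝ) / (b : ℝ) ^ ((i : ℕ) + 1)
       + ∑ i ∈ Finset.Icc (m + 1) n, ((a ⟨m + 1, by omega⟩).val : ℝ) / (b : ℝ) ^ i)

/-- The two-dimensional digital net (in `[0,1]²`) with generating matrices
`C₁, C₂ ∈ ℤ_b^{ℕ×m}`. -/
def netPts2 (b m : ℕ) (C₁ C₂ : ℕ → Fin m → ZMod b) : Multiset (ℝ × ℝ) :=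
  (Multiset.range (b ^ m)).map fun n =>
    (projG b (netPt b m 2 ![C₁, C₂] n 0), projG b (netPt b m 2 ![C₁, C₂] n 1))

/-- `l`-th row (`l` 1-based) of the first generating matrix `C₁` of the truncated
symmetrized Hammersley point set: `(C₁)_{l,j} = 1` iff (`j = l` and `l ≤ m`) or `j = m+1`. -/
def hamRow1 (b m : ℕ) (l : ℕ) : Fin (m + 2) → ZMod b := fun j =>
  if ((j : ℕ) + 1 = l ∧ l ≤ m) ∨ (j : ℕ) + 1 = m + 1 then 1 else 0

/-- `l`-th row (`l` 1-based) of the second generating matrix `C₂`: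
`(C₂)_{l,j} = 1` iff (`j = m+1-l` and `l ≤ m`) or `j = m+2`. -/
def hamRow2 (b m : ℕ) (l : ℕ) : Fin (m + 2) → ZMod b := fun j =>
  if ((j : ℕ) + 1 = m + 1 - l ∧ l ≤ m) ∨ (j : ℕ) + 1 = m + 2 then 1 else 0

/-- row selector for the two matrices. -/
def hamRow (b m : ℕ) : Fin 2 → ℕ → Fin (m + 2) → ZMod b := ![hamRow1 b m, hamRow2 b m]

/-- The truncated symmetrized Hammersley point set, given as the two-dimensional digital
net with the `n × (m+2)` generating matrices `C₁, C₂` above. -/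
def truncHamPts (b m n : ℕ) : Multiset (ℝ × ℝ) :=
  (Multiset.range (b ^ (m + 2))).map fun u =>
    (∑ i ∈ Finset.range n,
        ((∑ t : Fin (m + 2), zdgt b u (t : ℕ) * hamRow1 b m (i + 1) t).val : ℝ)
          / (b : ℝ) ^ (i + 1),
     ∑ i ∈ Finset.range n,
        ((∑ t : Fin (m + 2), zdgt b u (t : ℕ) * hamRow2 b m (i + 1) t).val : ℝ)
          / (b : ℝ) ^ (i + 1))

end Sym

namespace Sym

/-! ### Leading digits and the projection -/

/-- The integer whose `b`-adic digits, from the most significant one on, are the first `n`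
entries of `z`. -/
def leadIdx (b : ℕ) (z : G b) : ℕ → ℕ
  | 0 => 0
  | n + 1 => b * leadIdx b z n + (z n).val

section LeadIdx

variable {b : ℕ}

lemma leadIdx_lt [NeZero b] (z : G b) (n : ℕ) : leadIdx b z n < b ^ n := by
  induction n with
  | zero => simp [leadIdx]
  | succ n ih =>
    have h := ZMod.val_lt (z n)
    calc b * leadIdx b z n + (z n).val < b * (leadIdx b z n + 1) := by rw [mul_add_one]; omega
      _ ≤ b * b ^ n := Nat.mul_le_mul_left _ ih
      _ = b ^ (n + 1) := by ring

lemma leadIdx_succ_eq_iff [NeZero b] (z : G b) {n c e : ℕ} (he : e < b) :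
    leadIdx b z (n + 1) = b * c + e ↔ leadIdx b z n = c ∧ (z n).val = e := by
  have h := ZMod.val_lt (z n)
  rw [leadIdx]
  constructor
  · intro H
    have hc : leadIdx b z n = c := by
      have := congrArg (· / b) H
      simpa [Nat.mul_add_div (NeZero.pos b), Nat.div_eq_of_lt h, Nat.div_eq_of_lt he] using this
    subst hc
    exact ⟨rfl, by omega⟩
  · rintro ⟨rfl, rfl⟩
    rfl

lemma leadIdx_succ_lt_mul_iff [NeZero b] (z : G b) {n c : ℕ} :
    leadIdx b z (n + 1) < b * c ↔ leadIdx b z n < c := by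
  have h := ZMod.val_lt (z n)
  rw [leadIdx]
  constructor
  · intro H
    by_contra! hc
    have := Nat.mul_le_mul_left b hc
    omega
  · intro H
    have := Nat.mul_le_mul_left b (Nat.succ_le_of_lt H)
    rw [Nat.mul_succ] at this
    omega

lemma leadIdx_congr {z z' : G b} {n : ℕ} (h : ∀ i < n, z i = z' i) :
    leadIdx b z n = leadIdx b z' n := by
  induction n with
  | zero => rfl
  | succ n ih => rw [leadIdx, leadIdx, ih fun i hi => h i (by omega), h n (by omega)]

lemma exists_leadIdx_eq [NeZero b] {n c : ℕ} (hc : c < b ^ n) : ∃ z : G b, leadIdx b z n = c := by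
  induction n generalizing c with
  | zero => exact ⟨0, by simp at hc; simp [leadIdx, hc]⟩
  | succ n ih =>
    obtain ⟨z, hz⟩ := ih (c := c / b) (by
      rw [Nat.div_lt_iff_lt_mul (NeZero.pos b)]; simpa [pow_succ] using hc)
    refine ⟨Function.update z n (c : ZMod b), ?_⟩
    have hn : leadIdx b (Function.update z n (c : ZMod b)) n = c / b := by
      rw [← hz]
      exact leadIdx_congr fun i hi => Function.update_of_ne hi.ne _ _
    rw [leadIdx, hn, Function.update_self, ZMod.val_natCast, Nat.div_add_mod]

lemma summable_projG [NeZero b] (hb : 1 < b) (z : G b) :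
    Summable fun i : ℕ => ((z i).val : ℝ) / b ^ (i + 1) := by
  have hb' : (1 : ℝ) < b := by exact_mod_cast hb
  refine Summable.of_nonneg_of_le (fun i => by positivity) (fun i => ?_)
    (summable_geometric_of_lt_one (r := (b : ℝ)⁻¹) (by positivity) (inv_lt_one_of_one_lt₀ hb'))
  have h : ((z i).val : ℝ) ≤ b := by exact_mod_cast (ZMod.val_lt (z i)).le
  rw [inv_pow, pow_succ, div_le_iff₀ (by positivity)]
  field_simp
  exact h

lemma hasSum_pred_div_pow (hb : 1 < b) :
    HasSum (fun i : ℕ => ((b : ℝ) - 1) / b ^ (i + 1)) 1 := by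
  have hb' : (1 : ℝ) < b := by exact_mod_cast hb
  have hne : (b : ℝ) - 1 ≠ 0 := by linarith
  have h := (hasSum_geometric_of_lt_one (r := (b : ℝ)⁻¹) (by positivity)
    (inv_lt_one_of_one_lt₀ hb')).mul_left (((b : ℝ) - 1) / b)
  have hterm : (fun i : ℕ => ((b : ℝ) - 1) / b ^ (i + 1))
      = fun i : ℕ => ((b : ℝ) - 1) / b * (b : ℝ)⁻¹ ^ i := by
    funext i
    rw [inv_pow, pow_succ]
    field_simp
  have hval : ((b : ℝ) - 1) / b * (1 - (b : ℝ)⁻¹)⁻¹ = 1 := by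
    field_simp
  rw [hterm]
  rwa [hval] at h

lemma projG_nonneg (z : G b) : 0 ≤ projG b z := tsum_nonneg fun i => by positivity

lemma projG_le_one [NeZero b] (hb : 1 < b) (z : G b) : projG b z ≤ 1 := by
  rw [← (hasSum_pred_div_pow hb).tsum_eq]
  refine (summable_projG hb z).tsum_le_tsum (fun i => ?_) (hasSum_pred_div_pow hb).summable
  have h : ((z i).val : ℝ) + 1 ≤ b := by exact_mod_cast ZMod.val_lt (z i)
  gcongr
  linarith

lemma pow_mul_projG [NeZero b] (hb : 1 < b) (z : G b) (n : ℕ) :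
    (b : ℝ) ^ n * projG b z = leadIdx b z n + projG b fun i => z (n + i) := by
  have hb0 : (b : ℝ) ≠ 0 := NeZero.ne _
  induction n with
  | zero => simp [leadIdx]
  | succ n ih =>
    have h : (b : ℝ) * projG b (fun i => z (n + i))
        = (z n).val + projG b fun i => z (n + 1 + i) := by
      rw [projG, (summable_projG hb _).tsum_eq_zero_add, mul_add, ← tsum_mul_left, projG]
      congr 1
      · simp
        field_simp
      · refine tsum_congr fun i => ?_
        rw [pow_succ _ (i + 1), show n + (i + 1) = n + 1 + i by ring]
        field_simp
    rw [pow_succ', mul_assoc, ih, mul_add, h, leadIdx]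
    push_cast
    ring

end LeadIdx

end Sym

namespace Sym

/-! ### Natural numbers with prescribed digits -/

section Digits

variable {b : ℕ}

/-- The natural number whose `i`-th `b`-adic digit is `g i` for `i < L`. -/
def ofZDigits (b : ℕ) (g : ℕ → ZMod b) (L : ℕ) : ℕ := ∑ i ∈ Finset.range L, (g i).val * b ^ i

lemma ofZDigits_lt [NeZero b] (g : ℕ → ZMod b) (L : ℕ) : ofZDigits b g L < b ^ L := by
  induction L with
  | zero => simp [ofZDigits]
  | succ L ih =>
    have h := ZMod.val_lt (g L)
    rw [ofZDigits] at ih ⊢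
    rw [Finset.sum_range_succ, pow_succ']
    have := Nat.mul_le_mul_right (b ^ L) (Nat.succ_le_of_lt h)
    rw [Nat.succ_mul] at this
    omega

lemma zdgt_eq_zero_of_lt [NeZero b] {k i : ℕ} (h : k < b ^ i) : zdgt b k i = 0 := by
  simp [zdgt, dgt, Nat.div_eq_of_lt h]

lemma zdgt_ofZDigits [NeZero b] (g : ℕ → ZMod b) {L i : ℕ} (hi : i < L) :
    zdgt b (ofZDigits b g L) i = g i := by
  induction L with
  | zero => omega
  | succ L ih =>
    rw [ofZDigits, Finset.sum_range_succ, ← ofZDigits]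
    rcases Nat.lt_succ_iff_lt_or_eq.mp hi with h | rfl
    · rw [← ih h, zdgt, zdgt, dgt, dgt]
      congr 1
      obtain ⟨d, rfl⟩ := Nat.exists_eq_add_of_lt h
      rw [show (g (i + d + 1)).val * b ^ (i + d + 1)
        = b ^ i * (b * ((g (i + d + 1)).val * b ^ d)) by ring,
        Nat.add_mul_div_left _ _ (pow_pos (NeZero.pos b) i), Nat.add_mul_mod_self_left]
    · rw [zdgt, dgt, mul_comm, Nat.add_mul_div_left _ _ (pow_pos (NeZero.pos b) i),
        Nat.div_eq_of_lt (ofZDigits_lt g i), zero_add, Nat.mod_eq_of_lt (ZMod.val_lt _),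
        ZMod.natCast_zmod_val]

lemma ofZDigits_eq_of_support {g : ℕ → ZMod b} {n L : ℕ} (hn : n ≤ L)
    (hg : ∀ i, n ≤ i → i < L → g i = 0) : ofZDigits b g L = ofZDigits b g n := by
  refine (Finset.sum_subset (Finset.range_mono hn) fun i hi hi' => ?_).symm
  rw [Finset.mem_range] at hi hi'
  rw [hg i (by omega) hi, ZMod.val_zero, zero_mul]

lemma sum_range_zdgt_mul [NeZero b] (hb : 1 < b) {k L : ℕ} (hk : k < b ^ L) (f : ℕ → ZMod b) :
    ∑ i ∈ Finset.range k, zdgt b k i * f i = ∑ i ∈ Finset.range L, zdgt b k i * f i := by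
  have key : ∀ N : ℕ, k < b ^ N → ∑ i ∈ Finset.range N, zdgt b k i * f i
      = ∑ i ∈ Finset.range (max k L), zdgt b k i * f i ∨ max k L < N := by
    intro N hN
    rcases le_or_gt N (max k L) with h | h
    · left
      refine Finset.sum_subset (Finset.range_mono h) fun i _ hi => ?_
      rw [Finset.mem_range, not_lt] at hi
      rw [zdgt_eq_zero_of_lt (hN.trans_le (Nat.pow_le_pow_right (NeZero.pos b) hi)), zero_mul]
    · exact Or.inr h
  rw [(key k (Nat.lt_pow_self hb)).resolve_right (by simp),
    (key L hk).resolve_right (by simp)]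

lemma mu2_le_two_mul {k n : ℕ} (hk : k < b ^ n) : mu2 b k ≤ 2 * n := by
  unfold mu2
  split_ifs with h0 h1
  · omega
  · have := Nat.log_lt_of_lt_pow h0 hk
    omega
  · have := Nat.log_lt_of_lt_pow h0 hk
    have := Nat.log_lt_of_lt_pow h1 ((Nat.mod_le _ _).trans_lt hk)
    omega

lemma mu2_add_mul_pow_le (hb : 1 < b) {r κ n a : ℕ} (hr : r < b ^ n) (hκ : κ < b) (hna : n ≤ a) :
    mu2 b (r + κ * b ^ a) ≤ a + 1 + n := by
  rcases Nat.eq_zero_or_pos κ with rfl | hpos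
  · have := mu2_le_two_mul (k := r + 0 * b ^ a) (by simpa using hr)
    omega
  have hra : r < b ^ a := hr.trans_le (Nat.pow_le_pow_right (by omega) hna)
  have hlog : Nat.log b (r + κ * b ^ a) = a := by
    refine Nat.log_eq_of_pow_le_of_lt_pow ?_ ?_
    · exact (Nat.le_mul_of_pos_left _ hpos).trans (Nat.le_add_left _ _)
    · rw [pow_succ']
      have := Nat.mul_le_mul_right (b ^ a) (Nat.succ_le_of_lt hκ)
      rw [Nat.succ_mul] at this
      omega
  unfold mu2
  rw [hlog, Nat.add_mul_mod_self_right, Nat.mod_eq_of_lt hra]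
  split_ifs with h0 h1
  · omega
  · omega
  · have := Nat.log_lt_of_lt_pow h1 hr
    omega

end Digits

/-! ### Equidistribution of nets of order two -/

section Net

variable {b m : ℕ}

/-- The digit sequence obtained from the coordinates `v` and the generating matrix `C`. -/
def netSeq (C : ℕ → Fin m → ZMod b) (v : Fin m → ZMod b) : G b := fun i => ∑ s, v s * C i s

lemma netSeq_add (C : ℕ → Fin m → ZMod b) (v u : Fin m → ZMod b) (i : ℕ) :
    netSeq C (v + u) i = netSeq C v i + netSeq C u i := by
  simp [netSeq, add_mul, Finset.sum_add_distrib]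

lemma netSeq_smul (C : ℕ → Fin m → ZMod b) (r : ZMod b) (v : Fin m → ZMod b) (i : ℕ) :
    netSeq C (r • v) i = r * netSeq C v i := by
  simp [netSeq, Finset.mul_sum, mul_assoc]

lemma exists_netSeq_eq [Fact b.Prime] (C₁ C₂ : ℕ → Fin m → ZMod b) (S S' : Finset ℕ)
    (hind : ∀ g g' : ℕ → ZMod b, (∀ i ∉ S, g i = 0) → (∀ i ∉ S', g' i = 0) →
      (∀ s, ∑ i ∈ S, g i * C₁ i s + ∑ i ∈ S', g' i * C₂ i s = 0) → g = 0 ∧ g' = 0)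
    (w w' : ℕ → ZMod b) :
    ∃ v : Fin m → ZMod b, (∀ i ∈ S, netSeq C₁ v i = w i) ∧ ∀ i ∈ S', netSeq C₂ v i = w' i := by
  let φ : (Fin m → ZMod b) →ₗ[ZMod b] (S → ZMod b) × (S' → ZMod b) :=
    { toFun := fun v => (fun i => netSeq C₁ v i, fun i => netSeq C₂ v i)
      map_add' := fun v u => by ext <;> simp [netSeq_add]
      map_smul' := fun r v => by ext <;> simp [netSeq_smul] }
  have hφ : LinearMap.range φ = ⊤ := by
    by_contra hne
    obtain ⟨f, hf, hker⟩ := Submodule.exists_le_ker_of_lt_top _ (lt_top_iff_ne_top.mpr hne)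
    let e : S → (S → ZMod b) × (S' → ZMod b) := fun i => (Pi.single i 1, 0)
    let e' : S' → (S → ZMod b) × (S' → ZMod b) := fun i => (0, Pi.single i 1)
    have hsplit : ∀ x : (S → ZMod b) × (S' → ZMod b),
        f x = ∑ i, x.1 i * f (e i) + ∑ i, x.2 i * f (e' i) := by
      intro x
      have hx : x = ∑ i, x.1 i • e i + ∑ i, x.2 i • e' i := by
        ext i
        · simp [e, e', Prod.fst_sum, Finset.sum_apply, Pi.single_apply]
        · simp [e, e', Prod.snd_sum, Finset.sum_apply, Pi.single_apply]
      conv_lhs => rw [hx]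
      simp only [map_add, map_sum, map_smul, smul_eq_mul]
    let g : ℕ → ZMod b := fun i => if h : i ∈ S then f (e ⟨i, h⟩) else 0
    let g' : ℕ → ZMod b := fun i => if h : i ∈ S' then f (e' ⟨i, h⟩) else 0
    have hzero := hind g g' (fun i hi => dif_neg hi) (fun i hi => dif_neg hi) fun s => by
      have h0 : f (φ (Pi.single s 1)) = 0 := hker ⟨_, rfl⟩
      rw [hsplit] at h0
      rw [← Finset.sum_coe_sort S, ← Finset.sum_coe_sort S', ← h0]
      congr 1 <;> refine Finset.sum_congr rfl fun i _ => ?_ <;>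
        simp [g, g', φ, netSeq, Pi.single_apply, mul_comm]
    refine hf (LinearMap.ext fun x => ?_)
    rw [hsplit, LinearMap.zero_apply]
    have h1 : ∀ i, f (e i) = 0 := fun i => by simpa [g] using congrFun hzero.1 i
    have h2 : ∀ i, f (e' i) = 0 := fun i => by simpa [g'] using congrFun hzero.2 i
    simp [h1, h2]
  obtain ⟨v, hv⟩ := LinearMap.range_eq_top.mp hφ (fun i => w i, fun i => w' i)
  exact ⟨v, fun i hi => congrFun (congrArg Prod.fst hv) ⟨i, hi⟩,
    fun i hi => congrFun (congrArg Prod.snd hv) ⟨i, hi⟩⟩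

lemma eq_zero_of_dual [NeZero b] (hb : 1 < b) {C₁ C₂ : ℕ → Fin m → ZMod b} {N : ℕ}
    (hdual : ∀ k : Fin 2 → ℕ, inDual b m 2 ![C₁, C₂] k → k ≠ 0 →
      N < mu2 b (k 0) + mu2 b (k 1))
    {S S' : Finset ℕ} {L L' : ℕ} (hS : S ⊆ Finset.range L) (hS' : S' ⊆ Finset.range L')
    {g g' : ℕ → ZMod b} (hg : ∀ i ∉ S, g i = 0) (hg' : ∀ i ∉ S', g' i = 0)
    (hsum : ∀ s, ∑ i ∈ S, g i * C₁ i s + ∑ i ∈ S', g' i * C₂ i s = 0)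
    (hmu : mu2 b (ofZDigits b g L) + mu2 b (ofZDigits b g' L') ≤ N) : g = 0 ∧ g' = 0 := by
  have hsupp : ∀ (T : Finset ℕ) (l : ℕ) (f : ℕ → ZMod b) (F : ℕ → ZMod b), T ⊆ Finset.range l →
      (∀ i ∉ T, f i = 0) →
      ∑ i ∈ Finset.range (ofZDigits b f l), zdgt b (ofZDigits b f l) i * F i
        = ∑ i ∈ T, f i * F i := by
    intro T l f F hT hf
    rw [sum_range_zdgt_mul hb (ofZDigits_lt f l)]
    rw [Finset.sum_congr rfl fun i hi => by rw [zdgt_ofZDigits f (Finset.mem_range.mp hi)]]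
    exact (Finset.sum_subset hT fun i _ hi => by rw [hf i hi, zero_mul]).symm
  have hzero : (![ofZDigits b g L, ofZDigits b g' L'] : Fin 2 → ℕ) = 0 := by
    by_contra hne
    refine absurd (hdual _ (fun s => ?_) hne) (not_lt.mpr (by simpa using hmu))
    simpa [Fin.sum_univ_two, hsupp S L g _ hS hg, hsupp S' L' g' _ hS' hg'] using hsum s
  have hvanish : ∀ (T : Finset ℕ) (l : ℕ) (f : ℕ → ZMod b), T ⊆ Finset.range l →
      (∀ i ∉ T, f i = 0) → ofZDigits b f l = 0 → f = 0 := by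
    intro T l f hT hf h0
    funext i
    by_cases hi : i ∈ T
    · rw [← zdgt_ofZDigits f (Finset.mem_range.mp (hT hi)), h0]
      simp [zdgt, dgt]
    · exact hf i hi
  exact ⟨hvanish S L g hS hg (by simpa using congrFun hzero 0),
    hvanish S' L' g' hS' hg' (by simpa using congrFun hzero 1)⟩

end Net

end Sym

namespace Sym

/-- The indices of those points whose digit sequences `X`, `Y` lie in the elementary box of
resolution `(n, B)` with position `(c, j)`. -/
def digitBox {b : ℕ} {V : Type*} [Fintype V] (X Y : V → G b) (n B c j : ℕ) : Finset V :=
  {v | leadIdx b (X v) n = c ∧ leadIdx b (Y v) B = j}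

section Equidistribution

variable {b m : ℕ}

lemma exists_netSeq_eq_of_dual [Fact b.Prime] {C₁ C₂ : ℕ → Fin m → ZMod b} {N : ℕ}
    (hdual : ∀ k : Fin 2 → ℕ, inDual b m 2 ![C₁, C₂] k → k ≠ 0 →
      N < mu2 b (k 0) + mu2 b (k 1)) {n B : ℕ} (h : 2 * n + 2 * B ≤ N) (w w' : ℕ → ZMod b) :
    ∃ v : Fin m → ZMod b, (∀ i < n, netSeq C₁ v i = w i) ∧ ∀ i < B, netSeq C₂ v i = w' i := by
  have hb := (Fact.out : b.Prime).one_lt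
  obtain ⟨v, hv, hv'⟩ := exists_netSeq_eq C₁ C₂ (Finset.range n) (Finset.range B)
    (fun g g' hg hg' hsum => eq_zero_of_dual hb hdual subset_rfl subset_rfl hg hg' hsum (by
      have h1 := mu2_le_two_mul (ofZDigits_lt g n)
      have h2 := mu2_le_two_mul (ofZDigits_lt g' B)
      omega)) w w'
  exact ⟨v, fun i hi => hv i (Finset.mem_range.mpr hi), fun i hi => hv' i (Finset.mem_range.mpr hi)⟩

lemma exists_netSeq_eq_one [Fact b.Prime] {C₁ C₂ : ℕ → Fin m → ZMod b} {N : ℕ}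
    (hdual : ∀ k : Fin 2 → ℕ, inDual b m 2 ![C₁, C₂] k → k ≠ 0 →
      N < mu2 b (k 0) + mu2 b (k 1)) {n a B : ℕ} (hna : n ≤ a) (h : a + 1 + n + 2 * B ≤ N) :
    ∃ v : Fin m → ZMod b, (∀ i < n, netSeq C₁ v i = 0) ∧ netSeq C₁ v a = 1 ∧
      ∀ i < B, netSeq C₂ v i = 0 := by
  have hb := (Fact.out : b.Prime).one_lt
  have hS : insert a (Finset.range n) ⊆ Finset.range (a + 1) := by
    intro i hi
    simp only [Finset.mem_insert, Finset.mem_range] at hi ⊢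
    omega
  obtain ⟨v, hv, hv'⟩ := exists_netSeq_eq C₁ C₂ (insert a (Finset.range n)) (Finset.range B)
    (fun g g' hg hg' hsum => eq_zero_of_dual hb hdual hS subset_rfl hg hg' hsum (by
      have h0 : ofZDigits b g (a + 1) = ofZDigits b g n + (g a).val * b ^ a := by
        rw [ofZDigits, Finset.sum_range_succ, ← ofZDigits, ofZDigits_eq_of_support hna]
        intro i hi hi'
        refine hg i fun hmem => ?_
        simp only [Finset.mem_insert, Finset.mem_range] at hmem
        omega
      have h1 := mu2_add_mul_pow_le hb (ofZDigits_lt g n) (ZMod.val_lt (g a)) hna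
      have h2 := mu2_le_two_mul (ofZDigits_lt g' B)
      rw [h0]
      omega)) (fun i => if i = a then 1 else 0) 0
  refine ⟨v, fun i hi => ?_, ?_, fun i hi => hv' i (Finset.mem_range.mpr hi)⟩
  · rw [hv i (by simp [hi]), if_neg (by omega)]
  · rw [hv a (by simp), if_pos rfl]

lemma leadIdx_add_congr {C : ℕ → Fin m → ZMod b} {n : ℕ} {u v v' : Fin m → ZMod b}
    [NeZero b] (h : leadIdx b (netSeq C v) n = leadIdx b (netSeq C v') n) :
    leadIdx b (netSeq C (v + u)) n = leadIdx b (netSeq C (v' + u)) n := by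
  have hinj : ∀ (z z' : G b) (n : ℕ), leadIdx b z n = leadIdx b z' n → ∀ i < n, z i = z' i := by
    intro z z' n
    induction n with
    | zero => intro _ i hi; omega
    | succ n ih =>
      intro H i hi
      obtain ⟨h1, h2⟩ := (leadIdx_succ_eq_iff z (ZMod.val_lt (z' n))).mp H
      rcases Nat.lt_succ_iff_lt_or_eq.mp hi with hi | rfl
      · exact ih h1 i hi
      · exact ZMod.val_injective b h2
  exact leadIdx_congr fun i hi => by rw [netSeq_add, netSeq_add, hinj _ _ _ h i hi]

lemma card_digitBox_netSeq [Fact b.Prime] {C₁ C₂ : ℕ → Fin m → ZMod b} {N : ℕ}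
    (hdual : ∀ k : Fin 2 → ℕ, inDual b m 2 ![C₁, C₂] k → k ≠ 0 →
      N < mu2 b (k 0) + mu2 b (k 1)) {n B : ℕ} (h : 2 * n + 2 * B ≤ N) {c j : ℕ}
    (hc : c < b ^ n) (hj : j < b ^ B) :
    b ^ (n + B) * (digitBox (netSeq C₁) (netSeq C₂) n B c j).card = b ^ m := by
  have hle : ∀ c j c' j', c < b ^ n → j < b ^ B → c' < b ^ n → j' < b ^ B →
      (digitBox (netSeq C₁) (netSeq C₂) n B c j).card
        ≤ (digitBox (netSeq C₁) (netSeq C₂) n B c' j').card := by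
    intro c j c' j' hc hj hc' hj'
    obtain ⟨z, hz⟩ := exists_leadIdx_eq hc
    obtain ⟨y, hy⟩ := exists_leadIdx_eq hj
    obtain ⟨z', hz'⟩ := exists_leadIdx_eq hc'
    obtain ⟨y', hy'⟩ := exists_leadIdx_eq hj'
    obtain ⟨v, hv1, hv2⟩ := exists_netSeq_eq_of_dual hdual h z y
    obtain ⟨v', hv1', hv2'⟩ := exists_netSeq_eq_of_dual hdual h z' y'
    refine Finset.card_le_card_of_injOn (· + (v' - v)) (fun x hx => ?_)
      (add_left_injective _).injOn
    simp only [digitBox, Finset.coe_filter, Finset.mem_univ, true_and, Set.mem_ofPred_eq] at hx ⊢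
    constructor
    · rw [leadIdx_add_congr (v' := v) (by rw [hx.1, ← hz]; exact (leadIdx_congr hv1).symm),
        add_sub_cancel, ← hz']
      exact leadIdx_congr hv1'
    · rw [leadIdx_add_congr (v' := v) (by rw [hx.2, ← hy]; exact (leadIdx_congr hv2).symm),
        add_sub_cancel, ← hy']
      exact leadIdx_congr hv2'
  have hcard := Finset.card_eq_sum_card_fiberwise (s := (Finset.univ : Finset (Fin m → ZMod b)))
    (t := Finset.range (b ^ n) ×ˢ Finset.range (b ^ B))
    (f := fun v => (leadIdx b (netSeq C₁ v) n, leadIdx b (netSeq C₂ v) B))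
    (fun v _ => by simp [leadIdx_lt])
  rw [Finset.card_univ, Fintype.card_fun, ZMod.card, Fintype.card_fin] at hcard
  rw [hcard, Finset.sum_congr rfl (g := fun _ => (digitBox (netSeq C₁) (netSeq C₂) n B c j).card)]
  · simp [pow_add]
  · rintro ⟨c', j'⟩ hmem
    rw [Finset.mem_product, Finset.mem_range, Finset.mem_range] at hmem
    simp only [Prod.mk.injEq]
    exact le_antisymm (hle _ _ _ _ hmem.1 hmem.2 hc hj) (hle _ _ _ _ hc hj hmem.1 hmem.2)

lemma sum_zmod_val_centered [NeZero b] :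
    ∑ s : ZMod b, (((b : ℝ) - 1) / 2 - (s.val : ℝ)) = 0 := by
  have hneg : ∀ s : ZMod b, (((-1 - s).val : ℕ) : ℝ) = b - 1 - s.val := by
    intro s
    have h := ZMod.val_lt s
    have : (-1 - s : ZMod b) = ((b - 1 - s.val : ℕ) : ZMod b) := by
      rw [Nat.sub_sub, Nat.cast_sub (by omega)]
      simp
      ring
    rw [this, ZMod.val_natCast, Nat.mod_eq_of_lt (by omega), Nat.sub_sub, Nat.cast_sub (by omega)]
    push_cast
    ring
  have hinv := Equiv.sum_comp (Equiv.subLeft (-1 : ZMod b))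
    fun s : ZMod b => (((b : ℝ) - 1) / 2 - (s.val : ℝ))
  simp only [Equiv.subLeft_apply, hneg] at hinv
  have hsum := congrArg₂ (· + ·) hinv (Eq.refl (∑ s : ZMod b, (((b : ℝ) - 1) / 2 - (s.val : ℝ))))
  simp only [← Finset.sum_add_distrib] at hsum
  rw [Finset.sum_eq_zero fun s _ => by ring] at hsum
  rw [Finset.sum_add_distrib] at hsum
  linarith

lemma sum_digitBox_netSeq [Fact b.Prime] {C₁ C₂ : ℕ → Fin m → ZMod b} {N : ℕ}
    (hdual : ∀ k : Fin 2 → ℕ, inDual b m 2 ![C₁, C₂] k → k ≠ 0 →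
      N < mu2 b (k 0) + mu2 b (k 1)) {n a B : ℕ} (hna : n ≤ a) (h : a + 1 + n + 2 * B ≤ N)
    (c j : ℕ) :
    ∑ v ∈ digitBox (netSeq C₁) (netSeq C₂) n B c j,
      (((b : ℝ) - 1) / 2 - ((netSeq C₁ v a).val : ℝ)) = 0 := by
  obtain ⟨u, hu1, hua, hu2⟩ := exists_netSeq_eq_one hdual hna h
  have hbox : ∀ (s : ZMod b) (v : Fin m → ZMod b),
      v + s • u ∈ digitBox (netSeq C₁) (netSeq C₂) n B c j
        ↔ v ∈ digitBox (netSeq C₁) (netSeq C₂) n B c j := by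
    intro s v
    have h1 : leadIdx b (netSeq C₁ (v + s • u)) n = leadIdx b (netSeq C₁ v) n :=
      leadIdx_congr fun i hi => by rw [netSeq_add, netSeq_smul, hu1 i hi, mul_zero, add_zero]
    have h2 : leadIdx b (netSeq C₂ (v + s • u)) B = leadIdx b (netSeq C₂ v) B :=
      leadIdx_congr fun i hi => by rw [netSeq_add, netSeq_smul, hu2 i hi, mul_zero, add_zero]
    simp [digitBox, h1, h2]
  have hshift : ∀ s : ZMod b,
      ∑ v ∈ digitBox (netSeq C₁) (netSeq C₂) n B c j,
          (((b : ℝ) - 1) / 2 - ((netSeq C₁ v a).val : ℝ))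
        = ∑ v ∈ digitBox (netSeq C₁) (netSeq C₂) n B c j,
          (((b : ℝ) - 1) / 2 - ((netSeq C₁ v a + s).val : ℝ)) := by
    intro s
    refine (Finset.sum_equiv (Equiv.addRight (s • u)) (fun v => ?_) fun v _ => ?_).symm
    · exact (hbox s v).symm
    · simp [netSeq_add, netSeq_smul, hua]
  have havg : (Finset.univ : Finset (ZMod b)).card •
      ∑ v ∈ digitBox (netSeq C₁) (netSeq C₂) n B c j,
      (((b : ℝ) - 1) / 2 - ((netSeq C₁ v a).val : ℝ)) = 0 := by
    rw [← Finset.sum_const, Finset.sum_congr rfl fun s _ => hshift s, Finset.sum_comm]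
    refine Finset.sum_eq_zero fun v _ => ?_
    rw [← sum_zmod_val_centered (b := b)]
    exact Equiv.sum_comp (Equiv.addLeft (netSeq C₁ v a))
      fun s : ZMod b => (((b : ℝ) - 1) / 2 - (s.val : ℝ))
  rw [Finset.card_univ, ZMod.card] at havg
  exact (smul_eq_zero.mp havg).resolve_left (NeZero.ne b)

end Equidistribution

end Sym

namespace Sym

/-! ### Local discrepancy averaged over elementary intervals -/

/-- Equidistribution of a family of pairs of digit sequences, as satisfied by a digital net of
`b ^ m` points whose minimum Dick weight exceeds `2 * m - t`. -/
structure OrderTwo {b : ℕ} {V : Type*} [Fintype V] (m t : ℕ) (X Y : V → G b) : Prop where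
  card_digitBox : ∀ n B c j : ℕ, 2 * n + 2 * B ≤ 2 * m - t → c < b ^ n → j < b ^ B →
    b ^ (n + B) * (digitBox X Y n B c j).card = b ^ m
  sum_digitBox : ∀ n a B c j : ℕ, n ≤ a → a + 1 + n + 2 * B ≤ 2 * m - t →
    ∑ v ∈ digitBox X Y n B c j, (((b : ℝ) - 1) / 2 - ((X v a).val : ℝ)) = 0

section Discrepancy

variable {b : ℕ} {V : Type*} [Fintype V]

/-- The indicator of `π(z) < x`. -/
def below (b : ℕ) (x : ℝ) (z : G b) : ℝ := if projG b z < x then 1 else 0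

lemma below_nonneg (x : ℝ) (z : G b) : 0 ≤ below b x z := by
  unfold below; split_ifs <;> norm_num

lemma below_le_one (x : ℝ) (z : G b) : below b x z ≤ 1 := by
  unfold below; split_ifs <;> norm_num

lemma abs_below_sub_le [NeZero b] (hb : 1 < b) {x : ℝ} (hx : 0 ≤ x) (z : G b) (n : ℕ) :
    |below b x z - (if leadIdx b z n < ⌊x * (b : ℝ) ^ n⌋₊ then 1 else 0)|
      ≤ (if leadIdx b z n = ⌊x * (b : ℝ) ^ n⌋₊ - 1 then 1 else 0)
        + (if leadIdx b z n = ⌊x * (b : ℝ) ^ n⌋₊ then 1 else 0) := by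
  have hpow : (0 : ℝ) < (b : ℝ) ^ n := pow_pos (by exact_mod_cast NeZero.pos b) n
  have hproj := pow_mul_projG hb z n
  have h0 := projG_nonneg fun i => z (n + i)
  have h1 := projG_le_one hb fun i => z (n + i)
  have hq0 := Nat.floor_le (mul_nonneg hx hpow.le)
  have hq1 := Nat.lt_floor_add_one (x * (b : ℝ) ^ n)
  generalize ⌊x * (b : ℝ) ^ n⌋₊ = q at hq0 hq1 ⊢
  generalize leadIdx b z n = k at hproj ⊢
  unfold below
  rcases lt_trichotomy k q with h | h | h
  · rcases Nat.lt_or_ge (k + 1) q with h' | h'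
    · have hlt : projG b z < x := by
        refine lt_of_mul_lt_mul_left ?_ hpow.le
        have : (k : ℝ) + 1 < q := by exact_mod_cast h'
        linarith
      rw [if_pos hlt, if_pos h]
      split_ifs <;> norm_num
    · rw [if_pos (show k = q - 1 by omega)]
      split_ifs <;> norm_num
  · rw [if_pos h]
    split_ifs <;> norm_num
  · have hnlt : ¬ projG b z < x := by
      refine not_lt.mpr (le_of_mul_le_mul_left ?_ hpow)
      have : (q : ℝ) + 1 ≤ k := by exact_mod_cast h
      linarith
    rw [if_neg hnlt, if_neg (show ¬ k < q by omega)]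
    split_ifs <;> norm_num

lemma abs_sum_below_mul_sub_le [NeZero b] (hb : 1 < b) (X Y : V → G b) {y : ℝ} (hy : 0 ≤ y)
    (n B c : ℕ) {f : V → ℝ} {K P : ℝ} (hK : 0 ≤ K) (hf : ∀ v, |f v| ≤ K)
    (hP : ∀ j, ((digitBox X Y n B c j).card : ℝ) ≤ P) :
    |∑ v with leadIdx b (X v) n = c, below b y (Y v) * f v
      - ∑ j ∈ Finset.range ⌊y * (b : ℝ) ^ B⌋₊, ∑ v ∈ digitBox X Y n B c j, f v| ≤ 2 * K * P := by
  set q := ⌊y * (b : ℝ) ^ B⌋₊ with hq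
  set A : Finset V := {v | leadIdx b (X v) n = c} with hA
  have hbox : ∀ j (g : V → ℝ), ∑ v ∈ digitBox X Y n B c j, g v
      = ∑ v ∈ A, if leadIdx b (Y v) B = j then g v else 0 := by
    intro j g
    rw [← Finset.sum_filter, hA, Finset.filter_filter]
    rfl
  have hmain : ∑ j ∈ Finset.range q, ∑ v ∈ digitBox X Y n B c j, f v
      = ∑ v ∈ A, (if leadIdx b (Y v) B < q then 1 else 0) * f v := by
    simp_rw [hbox]
    rw [Finset.sum_comm]
    refine Finset.sum_congr rfl fun v _ => ?_
    rw [Finset.sum_ite_eq]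
    simp [Finset.mem_range]
  have hcard : ∀ j, ∑ v ∈ A, (if leadIdx b (Y v) B = j then K else 0) ≤ K * P := by
    intro j
    rw [← hbox j fun _ => K, Finset.sum_const, nsmul_eq_mul, mul_comm]
    exact mul_le_mul_of_nonneg_left (hP j) hK
  rw [hmain, ← Finset.sum_sub_distrib]
  calc |∑ v ∈ A, (below b y (Y v) * f v - (if leadIdx b (Y v) B < q then 1 else 0) * f v)|
      ≤ ∑ v ∈ A, |below b y (Y v) * f v - (if leadIdx b (Y v) B < q then 1 else 0) * f v| :=
        Finset.abs_sum_le_sum_abs _ _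
    _ ≤ ∑ v ∈ A, ((if leadIdx b (Y v) B = q - 1 then K else 0)
        + (if leadIdx b (Y v) B = q then K else 0)) := by
        refine Finset.sum_le_sum fun v _ => ?_
        have h := mul_le_mul (abs_below_sub_le hb hy (Y v) B) (hf v) (abs_nonneg _)
          (by split_ifs <;> norm_num)
        rw [← sub_mul, abs_mul]
        refine h.trans_eq ?_
        rw [add_mul, ite_mul, ite_mul, one_mul, zero_mul]
    _ ≤ 2 * K * P := by
        rw [Finset.sum_add_distrib]
        linarith [hcard (q - 1), hcard q]

section OrderTwo

variable [NeZero b] {m t : ℕ} {X Y : V → G b}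

lemma OrderTwo.card_digitBox_eq (h : OrderTwo m t X Y) {n B c j : ℕ}
    (hnB : 2 * n + 2 * B ≤ 2 * m - t) (hc : c < b ^ n) (hj : j < b ^ B) :
    (digitBox X Y n B c j).card = b ^ (m - n - B) := by
  have h1 := h.card_digitBox n B c j hnB hc hj
  have h2 : b ^ m = b ^ (n + B) * b ^ (m - n - B) := by
    rw [← pow_add]
    congr 1
    omega
  exact Nat.eq_of_mul_eq_mul_left (pow_pos (NeZero.pos b) _) (h1.trans h2)

lemma OrderTwo.card_digitBox_le (h : OrderTwo m t X Y) {n B c : ℕ} (j : ℕ)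
    (hnB : 2 * n + 2 * B ≤ 2 * m - t) (hc : c < b ^ n) :
    ((digitBox X Y n B c j).card : ℝ) ≤ (b : ℝ) ^ (m - n - B) := by
  by_cases hj : j < b ^ B
  · rw [h.card_digitBox_eq hnB hc hj, Nat.cast_pow]
  · have : digitBox X Y n B c j = ∅ := by
      refine Finset.filter_eq_empty_iff.mpr fun v _ hv => hj ?_
      rw [← hv.2]
      exact leadIdx_lt _ _
    rw [this, Finset.card_empty, Nat.cast_zero]
    positivity

/-- The local discrepancy of the elementary interval `(n, c)` times `[0, y)`, scaled by the
number `b ^ m` of points. -/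
def boxDisc (m : ℕ) (X Y : V → G b) (y : ℝ) (n c : ℕ) : ℝ :=
  ∑ v with leadIdx b (X v) n = c, below b y (Y v) - (b : ℝ) ^ m * y / (b : ℝ) ^ n

/-- The sum over the points in the elementary interval `(n, c)` times `[0, y)` of the signed
relative distance of the first coordinate to the midpoint of the interval. -/
def boxMoment (X Y : V → G b) (y : ℝ) (n c : ℕ) : ℝ :=
  ∑ v with leadIdx b (X v) n = c, below b y (Y v) * (1 / 2 - projG b fun i => X v (n + i))

/-- The scaled local discrepancy of the `c` leading elementary intervals of level `n`
times `[0, y)`. -/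
def cumDisc (m : ℕ) (X Y : V → G b) (y : ℝ) (n c : ℕ) : ℝ :=
  ∑ v with leadIdx b (X v) n < c, below b y (Y v) - c * ((b : ℝ) ^ m * y / (b : ℝ) ^ n)

/-- A primitive of the scaled local discrepancy at `(x, y)` as a function of `x`. -/
def primDisc (m : ℕ) (X Y : V → G b) (y x : ℝ) : ℝ :=
  ∑ v, below b y (Y v) * max (x - projG b (X v)) 0 - (b : ℝ) ^ m * y * x ^ 2 / 2

/-- The average over the elementary interval `(n, c)` of `x` of the scaled local discrepancy at
`(x, y)`. -/
def avgDisc (m : ℕ) (X Y : V → G b) (y : ℝ) (n c : ℕ) : ℝ :=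
  (b : ℝ) ^ n * (primDisc m X Y y ((c + 1 : ℕ) / (b : ℝ) ^ n)
    - primDisc m X Y y (c / (b : ℝ) ^ n))

lemma OrderTwo.abs_boxDisc_le (h : OrderTwo m t X Y) (hb : 1 < b) (ht : t ≤ 2 * m) {y : ℝ}
    (hy : 0 ≤ y) (hy1 : y ≤ 1) {n c : ℕ} (hn : n + (t + 1) / 2 ≤ m) (hc : c < b ^ n) :
    |boxDisc m X Y y n c| ≤ 3 * (b : ℝ) ^ ((t + 1) / 2) := by
  have hb0 : (0 : ℝ) < b := by exact_mod_cast NeZero.pos b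
  obtain ⟨B, hB⟩ : ∃ B, m = n + (t + 1) / 2 + B := ⟨m - (n + (t + 1) / 2), by omega⟩
  have hnB : 2 * n + 2 * B ≤ 2 * m - t := by omega
  have hexp : m - n - B = (t + 1) / 2 := by omega
  have hP := fun j => h.card_digitBox_le (c := c) j hnB hc
  have hcard := fun j (hj : j < b ^ B) => h.card_digitBox_eq hnB hc hj
  rw [hexp] at hP hcard
  have hpow : (0 : ℝ) < (b : ℝ) ^ B := by positivity
  have hP0 : (0 : ℝ) < (b : ℝ) ^ ((t + 1) / 2) := by positivity
  have hq0 := Nat.floor_le (mul_nonneg hy hpow.le)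
  have hq1 := Nat.lt_floor_add_one (y * (b : ℝ) ^ B)
  have key := abs_sum_below_mul_sub_le hb X Y hy n B c (f := fun _ => 1) zero_le_one
    (fun _ => by simp) hP
  have hqB : ⌊y * (b : ℝ) ^ B⌋₊ ≤ b ^ B := by
    refine Nat.floor_le_of_le ?_
    push_cast
    exact mul_le_of_le_one_left hpow.le hy1
  have hsum : ∑ j ∈ Finset.range ⌊y * (b : ℝ) ^ B⌋₊, ∑ v ∈ digitBox X Y n B c j, (1 : ℝ)
      = ⌊y * (b : ℝ) ^ B⌋₊ * (b : ℝ) ^ ((t + 1) / 2) := by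
    rw [Finset.sum_congr rfl (g := fun _ => (b : ℝ) ^ ((t + 1) / 2)), Finset.sum_const,
      Finset.card_range, nsmul_eq_mul]
    intro j hj
    rw [Finset.sum_const, hcard j ((Finset.mem_range.mp hj).trans_le hqB), nsmul_one, Nat.cast_pow]
  rw [hsum] at key
  simp only [mul_one] at key
  have hvol : (b : ℝ) ^ m * y / (b : ℝ) ^ n = y * (b : ℝ) ^ B * (b : ℝ) ^ ((t + 1) / 2) := by
    rw [hB, pow_add, pow_add]
    field_simp
  rw [boxDisc, hvol]
  rw [abs_le] at key ⊢
  constructor <;> nlinarith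

lemma OrderTwo.abs_sum_below_mul_centered_le (h : OrderTwo m t X Y) (hb : 1 < b) (ht : t ≤ 2 * m)
    {y : ℝ} (hy : 0 ≤ y) {n c : ℕ} (hn : n + (t + 1) / 2 ≤ m) (hc : c < b ^ n)
    (i : ℕ) :
    |∑ v with leadIdx b (X v) n = c,
      below b y (Y v) * (((b : ℝ) - 1) / 2 - ((X v (n + i)).val : ℝ))|
      ≤ 2 * b * √(b : ℝ) ^ (i + t + 2) := by
  have hb1 : (1 : ℝ) < b := by exact_mod_cast hb
  have hr : 1 ≤ √(b : ℝ) := Real.one_le_sqrt.mpr hb1.le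
  have hf : ∀ v, |((b : ℝ) - 1) / 2 - ((X v (n + i)).val : ℝ)| ≤ b := by
    intro v
    have h1 : ((X v (n + i)).val : ℝ) + 1 ≤ b := by exact_mod_cast ZMod.val_lt (X v (n + i))
    have h0 : (0 : ℝ) ≤ ((X v (n + i)).val : ℝ) := Nat.cast_nonneg _
    rw [abs_le]
    constructor <;> linarith
  have hroot : ∀ l k : ℕ, 2 * l ≤ k → (b : ℝ) ^ l ≤ √(b : ℝ) ^ k := by
    intro l k hlk
    rw [← Real.sq_sqrt (show (0 : ℝ) ≤ b by positivity), Real.sqrt_sq (by positivity), ← pow_mul]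
    exact pow_le_pow_right₀ hr hlk
  have hb0 : (0 : ℝ) ≤ b := by positivity
  by_cases hi : n + i + 1 + n ≤ 2 * m - t
  · set B := (2 * m - t - (n + i + 1 + n)) / 2 with hB
    have key := abs_sum_below_mul_sub_le hb X Y hy n B c hb0 hf
      fun j => h.card_digitBox_le (c := c) j (by omega) hc
    rw [Finset.sum_eq_zero fun j _ => h.sum_digitBox n (n + i) B c j (by omega) (by omega),
      sub_zero] at key
    refine key.trans ?_
    gcongr
    exact hroot _ _ (by omega)
  · refine (Finset.abs_sum_le_sum_abs _ _).trans ?_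
    refine (Finset.sum_le_card_nsmul _ _ (b : ℝ) fun v _ => ?_).trans ?_
    · rw [abs_mul, abs_of_nonneg (below_nonneg _ _)]
      exact (mul_le_of_le_one_left (abs_nonneg _) (below_le_one _ _)).trans (hf v)
    · have hcard := h.card_digitBox_le (n := n) (B := 0) (c := c) 0 (by omega) hc
      have hA : digitBox X Y n 0 c 0 = ({v | leadIdx b (X v) n = c} : Finset V) := by
        simp [digitBox, leadIdx]
      rw [hA] at hcard
      have h2 := hroot (m - n - 0) (i + t + 2) (by omega)
      rw [nsmul_eq_mul]
      have h3 : (0 : ℝ) ≤ √(b : ℝ) ^ (i + t + 2) := by positivity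
      nlinarith [mul_le_mul_of_nonneg_right (hcard.trans h2) hb0]

/-- The bound for `boxMoment`. -/
def momentBound (b t : ℕ) : ℝ := 2 * √(b : ℝ) ^ (t + 2) * (1 - (√(b : ℝ))⁻¹)⁻¹

lemma OrderTwo.abs_boxMoment_le (h : OrderTwo m t X Y) (hb : 1 < b) (ht : t ≤ 2 * m)
    {y : ℝ} (hy : 0 ≤ y) {n c : ℕ} (hn : n + (t + 1) / 2 ≤ m) (hc : c < b ^ n) :
    |boxMoment X Y y n c| ≤ momentBound b t := by
  have hb1 : (1 : ℝ) < b := by exact_mod_cast hb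
  have hb0 : (0 : ℝ) ≤ b := by positivity
  have hr : 1 < √(b : ℝ) := by rw [Real.lt_sqrt zero_le_one]; simpa using hb1
  have hseries : HasSum (fun i : ℕ => (∑ v with leadIdx b (X v) n = c,
      below b y (Y v) * (((b : ℝ) - 1) / 2 - ((X v (n + i)).val : ℝ))) / (b : ℝ) ^ (i + 1))
      (boxMoment X Y y n c) := by
    simp_rw [Finset.sum_div]
    refine hasSum_sum fun v _ => ?_
    have h1 := (hasSum_pred_div_pow hb).div_const 2
    have h2 := (summable_projG hb fun i => X v (n + i)).hasSum
    have h3 := (h1.sub h2).mul_left (below b y (Y v))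
    have hterm : (fun i : ℕ => below b y (Y v) * (((b : ℝ) - 1) / 2 - ((X v (n + i)).val : ℝ))
        / (b : ℝ) ^ (i + 1)) = fun i => below b y (Y v) * (((b : ℝ) - 1) / (b : ℝ) ^ (i + 1) / 2
          - ((X v (n + i)).val : ℝ) / (b : ℝ) ^ (i + 1)) := by
      funext i
      ring
    rw [hterm]
    exact h3
  have hgeom : HasSum (fun i : ℕ => 2 * √(b : ℝ) ^ (t + 2) * ((√(b : ℝ))⁻¹) ^ i)
      (momentBound b t) :=
    (hasSum_geometric_of_lt_one (by positivity) (inv_lt_one_of_one_lt₀ hr)).mul_left _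
  refine hseries.norm_le_of_bounded hgeom fun i => ?_
  rw [Real.norm_eq_abs, abs_div, abs_of_pos (show (0 : ℝ) < (b : ℝ) ^ (i + 1) by positivity),
    div_le_iff₀ (by positivity)]
  refine (h.abs_sum_below_mul_centered_le hb ht hy hn hc i).trans_eq ?_
  have hsq : (b : ℝ) ^ i = √(b : ℝ) ^ i * √(b : ℝ) ^ i := by
    rw [← mul_pow, Real.mul_self_sqrt hb0]
  rw [pow_succ (b : ℝ), hsq, inv_pow, show i + t + 2 = i + (t + 2) by ring, pow_add]
  field_simp

end OrderTwo

end Discrepancy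

end Sym

namespace Sym

section Average

variable {b : ℕ} {V : Type*} [Fintype V]

lemma cumDisc_zero (m : ℕ) (X Y : V → G b) (y : ℝ) (n : ℕ) : cumDisc m X Y y n 0 = 0 := by
  simp [cumDisc]

lemma cumDisc_succ (m : ℕ) (X Y : V → G b) (y : ℝ) (n c : ℕ) :
    cumDisc m X Y y n (c + 1) = cumDisc m X Y y n c + boxDisc m X Y y n c := by
  have h : ∑ v with leadIdx b (X v) n < c + 1, below b y (Y v)
      = ∑ v with leadIdx b (X v) n < c, below b y (Y v)
        + ∑ v with leadIdx b (X v) n = c, below b y (Y v) := by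
    simp only [Finset.sum_filter]
    rw [← Finset.sum_add_distrib]
    refine Finset.sum_congr rfl fun v _ => ?_
    rcases lt_trichotomy (leadIdx b (X v) n) c with h | h | h
    · rw [if_pos (by omega), if_pos h, if_neg (by omega), add_zero]
    · rw [if_pos (by omega), if_neg (by omega), if_pos h, zero_add]
    · rw [if_neg (by omega), if_neg (by omega), if_neg (by omega), add_zero]
  rw [cumDisc, cumDisc, boxDisc, h]
  push_cast
  ring

lemma cumDisc_succ_mul [NeZero b] (m : ℕ) (X Y : V → G b) (y : ℝ) (n c : ℕ) :
    cumDisc m X Y y (n + 1) (b * c) = cumDisc m X Y y n c := by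
  have hb : (b : ℝ) ≠ 0 := by exact_mod_cast NeZero.ne b
  simp only [cumDisc, leadIdx_succ_lt_mul_iff]
  rw [pow_succ]
  push_cast
  field_simp

lemma avgDisc_eq [NeZero b] (hb : 1 < b) (m : ℕ) (X Y : V → G b) (y : ℝ) (n c : ℕ) :
    avgDisc m X Y y n c
      = cumDisc m X Y y n c + boxDisc m X Y y n c / 2 + boxMoment X Y y n c := by
  have hpow : (0 : ℝ) < (b : ℝ) ^ n := pow_pos (by exact_mod_cast NeZero.pos b) n
  have hmax : ∀ (v : V) (d : ℕ), (b : ℝ) ^ n * max (d / (b : ℝ) ^ n - projG b (X v)) 0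
      = max (d - (leadIdx b (X v) n + projG b fun i => X v (n + i))) 0 := by
    intro v d
    rw [mul_max_of_nonneg _ _ hpow.le, mul_zero, mul_sub, pow_mul_projG hb, mul_div_cancel₀]
    exact hpow.ne'
  have hterm : ∀ v, (b : ℝ) ^ n * (below b y (Y v)
        * max ((c + 1 : ℕ) / (b : ℝ) ^ n - projG b (X v)) 0)
      - (b : ℝ) ^ n * (below b y (Y v) * max (c / (b : ℝ) ^ n - projG b (X v)) 0)
      = (if leadIdx b (X v) n < c then below b y (Y v) else 0)
        + (if leadIdx b (X v) n = c then below b y (Y v) else 0) / 2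
        + (if leadIdx b (X v) n = c then
            below b y (Y v) * (1 / 2 - projG b fun i => X v (n + i)) else 0) := by
    intro v
    rw [mul_left_comm, hmax, mul_left_comm, hmax]
    have h0 := projG_nonneg fun i => X v (n + i)
    have h1 := projG_le_one hb fun i => X v (n + i)
    generalize projG b (fun i => X v (n + i)) = τ at h0 h1 ⊢
    generalize leadIdx b (X v) n = k
    push_cast
    rcases lt_trichotomy k c with h | h | h
    · have h' : (k : ℝ) + 1 ≤ c := by exact_mod_cast h
      rw [max_eq_left (by linarith), max_eq_left (by linarith), if_pos h, if_neg h.ne, if_neg h.ne]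
      ring
    · subst h
      rw [max_eq_left (by linarith), max_eq_right (by linarith), if_neg (lt_irrefl k), if_pos rfl,
        if_pos rfl]
      ring
    · have h' : (c : ℝ) + 1 ≤ k := by exact_mod_cast h
      rw [max_eq_right (by linarith), max_eq_right (by linarith), if_neg h.not_gt, if_neg h.ne',
        if_neg h.ne']
      ring
  have hsum := Finset.sum_congr (rfl : (Finset.univ : Finset V) = _) fun v _ => hterm v
  rw [Finset.sum_sub_distrib, Finset.sum_add_distrib, Finset.sum_add_distrib, ← Finset.mul_sum,
    ← Finset.mul_sum, ← Finset.sum_div] at hsum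
  simp only [← Finset.sum_filter] at hsum
  rw [avgDisc, primDisc, primDisc, cumDisc, boxDisc, boxMoment]
  have hquad : (b : ℝ) ^ n * ((b : ℝ) ^ m * y * ((c + 1 : ℕ) / (b : ℝ) ^ n) ^ 2 / 2)
      - (b : ℝ) ^ n * ((b : ℝ) ^ m * y * (c / (b : ℝ) ^ n) ^ 2 / 2)
      = c * ((b : ℝ) ^ m * y / (b : ℝ) ^ n) + (b : ℝ) ^ m * y / (b : ℝ) ^ n / 2 := by
    push_cast
    field_simp
    ring
  linarith

lemma sum_avgDisc_succ [NeZero b] (m : ℕ) (X Y : V → G b) (y : ℝ) (n c : ℕ) :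
    ∑ e ∈ Finset.range b, avgDisc m X Y y (n + 1) (b * c + e) = b * avgDisc m X Y y n c := by
  have hb : (b : ℝ) ≠ 0 := by exact_mod_cast NeZero.ne b
  have htel := Finset.sum_range_sub
    (fun e : ℕ => primDisc m X Y y ((b * c + e : ℕ) / (b : ℝ) ^ (n + 1))) b
  have h1 : ((b * c + b : ℕ) : ℝ) / (b : ℝ) ^ (n + 1) = (c + 1 : ℕ) / (b : ℝ) ^ n := by
    push_cast
    rw [pow_succ]
    field_simp
  have h0 : ((b * c + 0 : ℕ) : ℝ) / (b : ℝ) ^ (n + 1) = c / (b : ℝ) ^ n := by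
    push_cast
    rw [pow_succ]
    field_simp
    ring
  simp only [avgDisc, ← Finset.mul_sum]
  simp only [← add_assoc] at htel
  rw [htel, h1, h0, pow_succ]
  ring

lemma momentBound_nonneg (hb : 1 < b) (t : ℕ) : 0 ≤ momentBound b t := by
  have hr : 1 ≤ √(b : ℝ) := Real.one_le_sqrt.mpr (by exact_mod_cast hb.le)
  exact mul_nonneg (by positivity) (inv_nonneg.mpr (sub_nonneg.mpr (inv_le_one_of_one_le₀ hr)))

section OrderTwo

variable [NeZero b] {m t : ℕ} {X Y : V → G b}

lemma OrderTwo.abs_avgDisc_sub_cumDisc_le (h : OrderTwo m t X Y) (hb : 1 < b) (ht : t ≤ 2 * m)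
    {y : ℝ} (hy : 0 ≤ y) (hy1 : y ≤ 1) {n c : ℕ} (hn : n + (t + 1) / 2 ≤ m) (hc : c < b ^ n) :
    |avgDisc m X Y y n c - cumDisc m X Y y n c|
      ≤ 3 * (b : ℝ) ^ ((t + 1) / 2) + momentBound b t := by
  have h1 := abs_le.mp (h.abs_boxDisc_le hb ht hy hy1 hn hc)
  have h2 := abs_le.mp (h.abs_boxMoment_le hb ht hy hn hc)
  rw [avgDisc_eq hb, abs_le]
  have h3 : (0 : ℝ) ≤ (b : ℝ) ^ ((t + 1) / 2) := by positivity
  constructor <;> linarith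

lemma OrderTwo.abs_cumDisc_succ_sub_le (h : OrderTwo m t X Y) (hb : 1 < b) (ht : t ≤ 2 * m)
    {y : ℝ} (hy : 0 ≤ y) (hy1 : y ≤ 1) {n c : ℕ} (hn : n + 1 + (t + 1) / 2 ≤ m) (hc : c < b ^ n)
    {e : ℕ} (he : e ≤ b) :
    |cumDisc m X Y y (n + 1) (b * c + e) - cumDisc m X Y y n c|
      ≤ e * (3 * (b : ℝ) ^ ((t + 1) / 2)) := by
  induction e with
  | zero => simp [cumDisc_succ_mul]
  | succ e ih =>
    have hlt : b * c + e < b ^ (n + 1) := by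
      calc b * c + e < b * (c + 1) := by rw [mul_add]; omega
        _ ≤ b ^ (n + 1) := by rw [pow_succ, mul_comm]; exact Nat.mul_le_mul_right _ hc
    have h1 := abs_le.mp (h.abs_boxDisc_le hb ht hy hy1 hn hlt)
    have h2 := abs_le.mp (ih (by omega))
    rw [← add_assoc, cumDisc_succ, abs_le]
    push_cast
    constructor <;> linarith

/-- The bound for the increments of `avgDisc`. -/
def incrBound (b t : ℕ) : ℝ :=
  (b + 2) * (3 * (b : ℝ) ^ ((t + 1) / 2)) + 2 * momentBound b t

lemma OrderTwo.abs_avgDisc_succ_sub_le (h : OrderTwo m t X Y) (hb : 1 < b) (ht : t ≤ 2 * m)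
    {y : ℝ} (hy : 0 ≤ y) (hy1 : y ≤ 1) {n c : ℕ} (hn : n + 1 + (t + 1) / 2 ≤ m) (hc : c < b ^ n)
    {e : ℕ} (he : e < b) :
    |avgDisc m X Y y (n + 1) (b * c + e) - avgDisc m X Y y n c| ≤ incrBound b t := by
  have hlt : b * c + e < b ^ (n + 1) := by
    calc b * c + e < b * (c + 1) := by rw [mul_add]; omega
      _ ≤ b ^ (n + 1) := by rw [pow_succ, mul_comm]; exact Nat.mul_le_mul_right _ hc
  have h1 := abs_le.mp (h.abs_avgDisc_sub_cumDisc_le hb ht hy hy1 hn hlt)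
  have h2 := abs_le.mp (h.abs_avgDisc_sub_cumDisc_le hb ht hy hy1 (n := n) (by omega) hc)
  have h3 := abs_le.mp (h.abs_cumDisc_succ_sub_le hb ht hy hy1 hn hc he.le)
  have h4 : (e : ℝ) * (3 * (b : ℝ) ^ ((t + 1) / 2)) ≤ b * (3 * (b : ℝ) ^ ((t + 1) / 2)) := by
    gcongr
  rw [incrBound, abs_le]
  constructor <;> linarith

lemma OrderTwo.abs_avgDisc_zero_le (h : OrderTwo m t X Y) (hb : 1 < b) (ht : t ≤ 2 * m)
    {y : ℝ} (hy : 0 ≤ y) (hy1 : y ≤ 1) :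
    |avgDisc m X Y y 0 0| ≤ 3 * (b : ℝ) ^ ((t + 1) / 2) + momentBound b t := by
  have h1 := h.abs_avgDisc_sub_cumDisc_le hb ht hy hy1 (n := 0) (c := 0) (by omega) (by simp)
  rwa [cumDisc_zero, sub_zero] at h1

lemma incrBound_pos (hb : 1 < b) (t : ℕ) : 0 < incrBound b t := by
  have h := momentBound_nonneg hb t
  have hb0 : (0 : ℝ) < b := by exact_mod_cast NeZero.pos b
  unfold incrBound
  positivity

end OrderTwo

end Average

end Sym

namespace Sym

/-! ### An exponential inequality for martingales on the `b`-adic tree -/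

lemma sum_range_mul_eq (f : ℕ → ℝ) (b n : ℕ) :
    ∑ i ∈ Finset.range (b * n), f i
      = ∑ c ∈ Finset.range n, ∑ e ∈ Finset.range b, f (b * c + e) := by
  induction n with
  | zero => simp
  | succ n ih => rw [mul_add, mul_one, Finset.sum_range_add, ih, Finset.sum_range_succ]

lemma sum_exp_le_of_martingale {b : ℕ} {S : ℕ → ℕ → ℝ} {K : ℝ} (hK : 0 < K) {M : ℕ}
    (hmart : ∀ n c, ∑ e ∈ Finset.range b, S (n + 1) (b * c + e) = b * S n c)
    (hinc : ∀ n < M, ∀ c < b ^ n, ∀ e < b, |S (n + 1) (b * c + e) - S n c| ≤ K) (r : ℝ) :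
    ∀ n ≤ M, ∑ c ∈ Finset.range (b ^ n), Real.exp (r * S n c)
      ≤ (b : ℝ) ^ n * Real.exp (r * S 0 0 + n * ((r * K) ^ 2 / 2)) := by
  intro n
  induction n with
  | zero => simp
  | succ n ih =>
    intro hn
    have hstep : ∀ c ∈ Finset.range (b ^ n),
        ∑ e ∈ Finset.range b, Real.exp (r * S (n + 1) (b * c + e))
          ≤ b * Real.exp ((r * K) ^ 2 / 2) * Real.exp (r * S n c) := by
      intro c hc
      calc ∑ e ∈ Finset.range b, Real.exp (r * S (n + 1) (b * c + e))
          ≤ ∑ e ∈ Finset.range b, Real.exp (r * S n c) * (Real.cosh (r * K)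
              + (S (n + 1) (b * c + e) - S n c) * (Real.sinh (r * K) / K)) := by
            refine Finset.sum_le_sum fun e he => ?_
            have hd := hinc n (by omega) c (Finset.mem_range.mp hc) e (Finset.mem_range.mp he)
            have h := Real.exp_mul_le_cosh_add_mul_sinh
              (t := (S (n + 1) (b * c + e) - S n c) / K)
              (by rwa [abs_div, abs_of_pos hK, div_le_one hK]) (r * K)
            have h1 : r * S (n + 1) (b * c + e)
                = r * S n c + (S (n + 1) (b * c + e) - S n c) / K * (r * K) := by
              field_simp
              ring
            rw [h1, Real.exp_add]
            refine mul_le_mul_of_nonneg_left (h.trans_eq ?_) (Real.exp_pos _).le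
            ring
        _ = b * Real.cosh (r * K) * Real.exp (r * S n c) := by
            rw [← Finset.mul_sum, Finset.sum_add_distrib, ← Finset.sum_mul,
              Finset.sum_sub_distrib, hmart]
            simp only [Finset.sum_const, Finset.card_range, nsmul_eq_mul]
            ring
        _ ≤ b * Real.exp ((r * K) ^ 2 / 2) * Real.exp (r * S n c) := by
            gcongr
            exact Real.cosh_le_exp_half_sq _
    rw [pow_succ', sum_range_mul_eq]
    refine (Finset.sum_le_sum hstep).trans ?_
    rw [← Finset.mul_sum]
    refine (mul_le_mul_of_nonneg_left (ih (by omega)) (by positivity)).trans_eq ?_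
    push_cast
    rw [add_mul, one_mul, ← add_assoc, Real.exp_add (_ + _), pow_succ]
    ring

lemma exists_rpow_le_exp (p : ℝ) (hp : 0 ≤ p) :
    ∃ A : ℝ, 0 < A ∧ ∀ u : ℝ, 0 ≤ u → u ^ p ≤ A * Real.exp u := by
  obtain ⟨k, hk⟩ := exists_nat_ge p
  refine ⟨1 + k.factorial, by positivity, fun u hu => ?_⟩
  have h1 := Real.one_le_exp hu
  have h2 : u ^ k ≤ k.factorial * Real.exp u := by
    have := Real.pow_div_factorial_le_exp u hu k
    rwa [div_le_iff₀' (by positivity)] at this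
  rcases le_total u 1 with h | h
  · have h3 := Real.rpow_le_one hu h hp
    nlinarith [pow_nonneg hu k]
  · have h3 := Real.rpow_le_rpow_of_exponent_le h hk
    rw [Real.rpow_natCast] at h3
    linarith

/-! ### Integrals of step functions -/

lemma setIntegral_le_sum_of_floor {N : ℕ} (hN : 0 < N) {w : ℕ → ℝ} (hw : ∀ c, 0 ≤ w c)
    {f : ℝ → ℝ} (hf : ∀ x, 0 ≤ f x) (hfw : ∀ x ∈ Set.Ico (0 : ℝ) 1, f x ≤ w ⌊x * N⌋₊) :
    ∫ x in Set.Icc (0 : ℝ) 1, f x ≤ (∑ c ∈ Finset.range N, w c) / N := by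
  have hN' : (0 : ℝ) < N := by exact_mod_cast hN
  let I : ℕ → Set ℝ := fun c => Set.Ico (c / N) ((c + 1) / N)
  let g : ℕ → ℝ → ℝ := fun c => (I c).indicator fun _ => w c
  have hg0 : ∀ c x, 0 ≤ g c x := fun c x => Set.indicator_nonneg (fun _ _ => hw c) x
  have hgint : ∀ c, Integrable (g c) := fun c =>
    (integrable_indicator_iff measurableSet_Ico).mpr (integrableOn_const measure_Ico_lt_top.ne)
  have hgval : ∀ c, ∫ x, g c x = w c / N := by
    intro c
    rw [integral_indicator measurableSet_Ico, setIntegral_const, Real.volume_real_Ico, smul_eq_mul,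
      max_eq_left]
    · ring
    · rw [← sub_div]
      simp [hN'.le]
  have hsum : Integrable fun x => ∑ c ∈ Finset.range N, g c x :=
    integrable_finsetSum _ fun c _ => hgint c
  rw [integral_Icc_eq_integral_Ico]
  calc ∫ x in Set.Ico (0 : ℝ) 1, f x
      ≤ ∫ x in Set.Ico (0 : ℝ) 1, ∑ c ∈ Finset.range N, g c x := by
        refine integral_mono_of_nonneg (Filter.Eventually.of_forall hf) hsum.integrableOn ?_
        refine (ae_restrict_iff' measurableSet_Ico).mpr (Filter.Eventually.of_forall fun x hx => ?_)
        have hx0 : 0 ≤ x * N := mul_nonneg hx.1 hN'.le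
        have hmem : ⌊x * N⌋₊ ∈ Finset.range N := by
          rw [Finset.mem_range, Nat.floor_lt hx0]
          exact mul_lt_of_lt_one_left hN' hx.2
        have hxI : x ∈ I ⌊x * N⌋₊ := by
          refine ⟨(div_le_iff₀ hN').mpr (Nat.floor_le hx0), (lt_div_iff₀ hN').mpr ?_⟩
          exact Nat.lt_floor_add_one _
        refine (hfw x hx).trans ?_
        refine le_trans (le_of_eq ?_) (Finset.single_le_sum (fun c _ => hg0 c x) hmem)
        exact (Set.indicator_of_mem hxI fun _ => w ⌊x * N⌋₊).symm
    _ ≤ ∫ x, ∑ c ∈ Finset.range N, g c x :=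
        setIntegral_le_integral hsum
          (Filter.Eventually.of_forall fun x => Finset.sum_nonneg fun c _ => hg0 c x)
    _ = (∑ c ∈ Finset.range N, w c) / N := by
        rw [integral_finsetSum _ fun c _ => hgint c, Finset.sum_div]
        exact Finset.sum_congr rfl fun c _ => hgval c

lemma setIntegral_Icc_prod_le {f : ℝ × ℝ → ℝ} (hf : ∀ z, 0 ≤ f z) {A : ℝ} (hA : 0 ≤ A)
    (h : ∀ y ∈ Set.Icc (0 : ℝ) 1, ∫ x in Set.Icc (0 : ℝ) 1, f (x, y) ≤ A) :
    ∫ z in Set.Icc ((0 : ℝ), (0 : ℝ)) (1, 1), f z ≤ A := by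
  by_cases hint : IntegrableOn f (Set.Icc ((0 : ℝ), (0 : ℝ)) (1, 1))
  · rw [← Set.Icc_prod_Icc, IntegrableOn, Measure.volume_eq_prod, ← Measure.prod_restrict] at hint
    rw [← Set.Icc_prod_Icc, Measure.volume_eq_prod, ← Measure.prod_restrict,
      integral_prod_symm _ hint]
    have hle := norm_setIntegral_le_of_norm_le_const (μ := volume) (s := Set.Icc (0 : ℝ) 1)
      (f := fun y => ∫ x in Set.Icc (0 : ℝ) 1, f (x, y)) (C := A) measure_Icc_lt_top fun y hy => by
        rw [Real.norm_of_nonneg (integral_nonneg fun x => hf _)]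
        exact h y hy
    simp only [Real.volume_real_Icc, sub_zero, max_eq_left zero_le_one, mul_one] at hle
    exact (le_abs_self _).trans hle
  · rw [integral_undef hint]
    exact hA

end Sym

namespace Sym

section LpBound

variable {b : ℕ} {V : Type*} [Fintype V]

/-- The local discrepancy at `(x, y)` scaled by the number `b ^ m` of points. -/
def scaledDisc (m : ℕ) (X Y : V → G b) (x y : ℝ) : ℝ :=
  ∑ v, below b x (X v) * below b y (Y v) - (b : ℝ) ^ m * (x * y)

variable [NeZero b] {m t : ℕ} {X Y : V → G b}

lemma OrderTwo.abs_scaledDisc_sub_cumDisc_le (h : OrderTwo m t X Y) (hb : 1 < b)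
    (ht : t ≤ 2 * m) {x y : ℝ} (hx : x ∈ Set.Ico (0 : ℝ) 1) (hy : 0 ≤ y) (hy1 : y ≤ 1) :
    |scaledDisc m X Y x y
      - cumDisc m X Y y (m - (t + 1) / 2) ⌊x * (b : ℝ) ^ (m - (t + 1) / 2)⌋₊|
      ≤ 3 * (b : ℝ) ^ ((t + 1) / 2) := by
  obtain ⟨n, hn⟩ : ∃ n, m = n + (t + 1) / 2 := ⟨m - (t + 1) / 2, by omega⟩
  rw [show m - (t + 1) / 2 = n by omega]
  have hpow : (0 : ℝ) < (b : ℝ) ^ n := pow_pos (by exact_mod_cast NeZero.pos b) n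
  have hq0 := Nat.floor_le (mul_nonneg hx.1 hpow.le)
  have hq1 := Nat.lt_floor_add_one (x * (b : ℝ) ^ n)
  have hq : ⌊x * (b : ℝ) ^ n⌋₊ < b ^ n := by
    rw [Nat.floor_lt (mul_nonneg hx.1 hpow.le)]
    push_cast
    exact mul_lt_of_lt_one_left hpow hx.2
  have hbelow := fun v => abs_below_sub_le hb hx.1 (X v) n
  set q := ⌊x * (b : ℝ) ^ n⌋₊ with hqdef
  have hcount : ∀ c < b ^ n, ∑ v, (if leadIdx b (X v) n = c then (1 : ℝ) else 0)
      ≤ (b : ℝ) ^ ((t + 1) / 2) := by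
    intro c hc
    have hcard := h.card_digitBox_le (n := n) (B := 0) (c := c) 0 (by omega) hc
    rw [show m - n - 0 = (t + 1) / 2 by omega] at hcard
    refine le_trans (le_of_eq ?_) hcard
    simp [digitBox, leadIdx]
  have hpoints : |∑ v, below b x (X v) * below b y (Y v)
      - ∑ v with leadIdx b (X v) n < q, below b y (Y v)| ≤ 2 * (b : ℝ) ^ ((t + 1) / 2) := by
    rw [Finset.sum_filter, ← Finset.sum_sub_distrib]
    refine (Finset.abs_sum_le_sum_abs _ _).trans ?_
    calc ∑ v, |below b x (X v) * below b y (Y v)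
          - (if leadIdx b (X v) n < q then below b y (Y v) else 0)|
        ≤ ∑ v, ((if leadIdx b (X v) n = q - 1 then (1 : ℝ) else 0)
            + (if leadIdx b (X v) n = q then 1 else 0)) := by
          refine Finset.sum_le_sum fun v _ => ?_
          have hs : below b x (X v) * below b y (Y v)
              - (if leadIdx b (X v) n < q then below b y (Y v) else 0)
              = (below b x (X v) - (if leadIdx b (X v) n < q then 1 else 0))
                * below b y (Y v) := by
            rw [sub_mul, ite_mul, one_mul, zero_mul]
          rw [hs, abs_mul, abs_of_nonneg (below_nonneg y (Y v))]
          exact (mul_le_of_le_one_right (abs_nonneg _) (below_le_one _ _)).trans (hbelow v)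
      _ ≤ 2 * (b : ℝ) ^ ((t + 1) / 2) := by
          rw [Finset.sum_add_distrib]
          linarith [hcount (q - 1) (by omega), hcount q hq]
  have hvol : (q : ℝ) * ((b : ℝ) ^ m * y / (b : ℝ) ^ n) = q * y * (b : ℝ) ^ ((t + 1) / 2) := by
    conv_lhs => rw [hn, pow_add]
    field_simp
  have hvol' : (b : ℝ) ^ m * (x * y) = x * (b : ℝ) ^ n * y * (b : ℝ) ^ ((t + 1) / 2) := by
    conv_lhs => rw [hn, pow_add]
    ring
  have hP : (0 : ℝ) < (b : ℝ) ^ ((t + 1) / 2) := by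
    have : (0 : ℝ) < b := by exact_mod_cast NeZero.pos b
    positivity
  have hd0 : 0 ≤ (x * (b : ℝ) ^ n - q) * y := mul_nonneg (by linarith) hy
  have hd1 : (x * (b : ℝ) ^ n - q) * y ≤ 1 := mul_le_one₀ (by linarith) hy hy1
  rw [scaledDisc, cumDisc, hvol, hvol']
  rw [abs_le] at hpoints ⊢
  constructor <;> nlinarith

lemma OrderTwo.abs_scaledDisc_sub_avgDisc_le (h : OrderTwo m t X Y) (hb : 1 < b)
    (ht : t ≤ 2 * m) {x y : ℝ} (hx : x ∈ Set.Ico (0 : ℝ) 1) (hy : 0 ≤ y) (hy1 : y ≤ 1) :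
    |scaledDisc m X Y x y
      - avgDisc m X Y y (m - (t + 1) / 2) ⌊x * (b : ℝ) ^ (m - (t + 1) / 2)⌋₊|
      ≤ incrBound b t := by
  have hpow : (0 : ℝ) < (b : ℝ) ^ (m - (t + 1) / 2) := pow_pos (by exact_mod_cast NeZero.pos b) _
  have hq : ⌊x * (b : ℝ) ^ (m - (t + 1) / 2)⌋₊ < b ^ (m - (t + 1) / 2) := by
    rw [Nat.floor_lt (mul_nonneg hx.1 hpow.le)]
    push_cast
    exact mul_lt_of_lt_one_left hpow hx.2
  have h1 := abs_le.mp (h.abs_scaledDisc_sub_cumDisc_le hb ht hx hy hy1)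
  have h2 := abs_le.mp (h.abs_avgDisc_sub_cumDisc_le hb ht hy hy1 (by omega) hq)
  have h3 := momentBound_nonneg hb t
  have h4 : (0 : ℝ) ≤ b * (3 * (b : ℝ) ^ ((t + 1) / 2)) := by positivity
  rw [incrBound, abs_le]
  constructor <;> linarith

lemma OrderTwo.setIntegral_scaledDisc_rpow_le (h : OrderTwo m t X Y) (hb : 1 < b) (hm : 1 ≤ m)
    (ht : t ≤ 2 * m) {y : ℝ} (hy : 0 ≤ y) (hy1 : y ≤ 1) {p A : ℝ} (hA : 0 ≤ A)
    (hexp : ∀ u : ℝ, 0 ≤ u → u ^ p ≤ A * Real.exp u) :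
    ∫ x in Set.Icc (0 : ℝ) 1, |scaledDisc m X Y x y| ^ p
      ≤ √(m : ℝ) ^ p * (2 * A * Real.exp (2 * incrBound b t + incrBound b t ^ 2 / 2)) := by
  set K := incrBound b t with hKdef
  set n := m - (t + 1) / 2 with hndef
  set S := avgDisc m X Y y with hS
  have hK : 0 < K := incrBound_pos hb t
  have hr1 : 1 ≤ √(m : ℝ) := Real.one_le_sqrt.mpr (by exact_mod_cast hm)
  have hr0 : 0 < √(m : ℝ) := by linarith
  have hbn : 0 < b ^ n := pow_pos (NeZero.pos b) n
  have hscale : ∀ z : ℝ, |z| ≤ K → |z / √(m : ℝ)| ≤ K := fun z hz => by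
    rw [abs_div, abs_of_pos hr0]
    exact (div_le_self (abs_nonneg z) hr1).trans hz
  have hsum : ∀ r : ℝ, |r| = (√(m : ℝ))⁻¹ → (∑ c ∈ Finset.range (b ^ n), Real.exp (r * S n c))
      ≤ (b : ℝ) ^ n * Real.exp (K + K ^ 2 / 2) := by
    intro r hr
    refine (sum_exp_le_of_martingale hK (sum_avgDisc_succ m X Y y)
      (fun k hk c hc e he => h.abs_avgDisc_succ_sub_le hb ht hy hy1 (by omega) hc he)
      r n le_rfl).trans ?_
    have hr2 : r ^ 2 = (m : ℝ)⁻¹ := by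
      rw [← sq_abs, hr, inv_pow, Real.sq_sqrt (Nat.cast_nonneg m)]
    have hm0 : (0 : ℝ) < m := by exact_mod_cast hm
    have h0 : |S 0 0| ≤ K := by
      refine (h.abs_avgDisc_zero_le hb ht hy hy1).trans ?_
      have h3 := momentBound_nonneg hb t
      have h4 : (0 : ℝ) ≤ b * (3 * (b : ℝ) ^ ((t + 1) / 2)) := by positivity
      have h5 : (0 : ℝ) ≤ (b : ℝ) ^ ((t + 1) / 2) := by positivity
      rw [hKdef, incrBound]
      linarith
    have h1 : r * S 0 0 ≤ K := by
      refine (le_abs_self _).trans ?_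
      rw [abs_mul, hr]
      exact (mul_le_of_le_one_left (abs_nonneg _) (inv_le_one_of_one_le₀ hr1)).trans h0
    have h2 : n * ((r * K) ^ 2 / 2) ≤ K ^ 2 / 2 := by
      have hnm : (n : ℝ) ≤ m := by exact_mod_cast Nat.sub_le _ _
      rw [mul_pow, hr2]
      calc (n : ℝ) * ((m : ℝ)⁻¹ * K ^ 2 / 2) ≤ m * ((m : ℝ)⁻¹ * K ^ 2 / 2) := by gcongr
        _ = K ^ 2 / 2 := by field_simp
    gcongr
  let w : ℕ → ℝ := fun c => √(m : ℝ) ^ p * (A * Real.exp K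
    * (Real.exp ((√(m : ℝ))⁻¹ * S n c) + Real.exp (-(√(m : ℝ))⁻¹ * S n c)))
  have hpoint : ∀ x ∈ Set.Ico (0 : ℝ) 1, |scaledDisc m X Y x y| ^ p ≤ w ⌊x * (b ^ n : ℕ)⌋₊ := by
    intro x hx
    have hd := h.abs_scaledDisc_sub_avgDisc_le hb ht hx hy hy1
    rw [← hndef, ← hS, ← hKdef] at hd
    push_cast
    simp only [w]
    generalize S n ⌊x * (b : ℝ) ^ n⌋₊ = s at hd ⊢
    generalize scaledDisc m X Y x y = d at hd ⊢
    have hu : |d| = √(m : ℝ) * (|d| / √(m : ℝ)) := by field_simp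
    rw [hu, Real.mul_rpow hr0.le (by positivity)]
    refine mul_le_mul_of_nonneg_left ((hexp _ (by positivity)).trans ?_) (by positivity)
    rw [mul_assoc]
    refine mul_le_mul_of_nonneg_left ?_ hA
    have h1 : |d| / √(m : ℝ) ≤ K + |(√(m : ℝ))⁻¹ * s| := by
      have h2 := hscale _ hd
      rw [← abs_of_pos hr0, ← abs_div, abs_of_pos hr0, inv_mul_eq_div]
      have h3 := abs_add_le ((d - s) / √(m : ℝ)) (s / √(m : ℝ))
      rw [← add_div, sub_add_cancel] at h3
      linarith
    refine (Real.exp_le_exp.mpr h1).trans ?_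
    rw [Real.exp_add]
    refine mul_le_mul_of_nonneg_left ?_ (Real.exp_pos _).le
    rw [neg_mul]
    exact Real.exp_abs_le _
  refine (setIntegral_le_sum_of_floor hbn (fun c => by positivity) (fun x => by positivity)
    hpoint).trans ?_
  rw [div_le_iff₀ (by exact_mod_cast hbn)]
  simp only [w, ← Finset.mul_sum]
  rw [Finset.sum_add_distrib, mul_assoc (√(m : ℝ) ^ p)]
  refine mul_le_mul_of_nonneg_left ?_ (by positivity)
  have hpos := hsum (√(m : ℝ))⁻¹ (abs_of_pos (by positivity))
  have hneg := hsum (-(√(m : ℝ))⁻¹) (by rw [abs_neg]; exact abs_of_pos (by positivity))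
  have hsplit : Real.exp (2 * K + K ^ 2 / 2) = Real.exp K * Real.exp (K + K ^ 2 / 2) := by
    rw [← Real.exp_add]
    ring_nf
  rw [hsplit]
  push_cast
  calc A * Real.exp K * (_ + _)
      ≤ A * Real.exp K * ((b : ℝ) ^ n * Real.exp (K + K ^ 2 / 2)
          + (b : ℝ) ^ n * Real.exp (K + K ^ 2 / 2)) := by gcongr
    _ = _ := by ring

end LpBound

/-! ### Digital nets -/

lemma orderTwo_netSeq {b m t : ℕ} [Fact b.Prime] {C₁ C₂ : ℕ → Fin m → ZMod b}
    (hdual : ∀ k : Fin 2 → ℕ, inDual b m 2 ![C₁, C₂] k → k ≠ 0 →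
      2 * m - t < mu2 b (k 0) + mu2 b (k 1)) :
    OrderTwo m t (netSeq C₁) (netSeq C₂) where
  card_digitBox _ _ _ _ hnB hc hj := card_digitBox_netSeq hdual hnB hc hj
  sum_digitBox _ _ _ c j hna ha := sum_digitBox_netSeq hdual hna ha c j

lemma sum_range_pow_zdgt {b : ℕ} [NeZero b] (m : ℕ) (f : (Fin m → ZMod b) → ℝ) :
    ∑ k ∈ Finset.range (b ^ m), f (fun s => zdgt b k s) = ∑ v, f v := by
  rw [Finset.sum_range fun k => f fun s => zdgt b k s]
  refine Fintype.sum_bijective (fun (k : Fin (b ^ m)) (s : Fin m) => zdgt b k s) ?_ _ _ fun _ => rfl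
  refine (Fintype.bijective_iff_injective_and_card _).mpr ⟨fun k l hkl => ?_, by simp⟩
  refine finFunctionFinEquiv.symm.injective (funext fun s => Fin.ext ?_)
  have h := congrArg ZMod.val (congrFun hkl s)
  simpa only [zdgt, dgt, ZMod.val_natCast, Nat.mod_mod, finFunctionFinEquiv_symm_apply_val] using h

lemma disc2_netPts2 {b m : ℕ} [NeZero b] (C₁ C₂ : ℕ → Fin m → ZMod b) (z : ℝ × ℝ) :
    disc2 (netPts2 b m C₁ C₂) z
      = scaledDisc m (netSeq C₁) (netSeq C₂) z.1 z.2 / (b : ℝ) ^ m := by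
  have hb : (b : ℝ) ≠ 0 := by exact_mod_cast NeZero.ne b
  have hsum : ((netPts2 b m C₁ C₂).map fun x =>
      if 0 ≤ x.1 ∧ x.1 < z.1 ∧ 0 ≤ x.2 ∧ x.2 < z.2 then (1 : ℝ) else 0).sum
      = ∑ v, below b z.1 (netSeq C₁ v) * below b z.2 (netSeq C₂ v) := by
    rw [← sum_range_pow_zdgt m fun v => below b z.1 (netSeq C₁ v) * below b z.2 (netSeq C₂ v),
      netPts2, Multiset.map_map]
    refine congrArg Multiset.sum (Multiset.map_congr rfl fun k _ => ?_)
    have h1 : netPt b m 2 ![C₁, C₂] k 0 = netSeq C₁ fun s => zdgt b k s := rfl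
    have h2 : netPt b m 2 ![C₁, C₂] k 1 = netSeq C₂ fun s => zdgt b k s := rfl
    simp only [Function.comp_apply, h1, h2, projG_nonneg, if_true, below, ite_and, ite_mul,
      one_mul, zero_mul]
  have hcard : ((netPts2 b m C₁ C₂).card : ℝ) = (b : ℝ) ^ m := by simp [netPts2]
  rw [disc2, hsum, hcard, scaledDisc]
  field_simp

end Sym

-- STATEMENT 16
theorem stmt16 (b : ℕ) (hb : b.Prime) (t : ℕ) (p : ℝ) (hp : 1 ≤ p) :
    ∃ C : ℝ, 0 < C ∧ ∀ m : ℕ, 1 ≤ m → t ≤ 2 * m →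
      ∀ C₁ C₂ : ℕ → Fin m → ZMod b,
        (∀ k : Fin 2 → ℕ, inDual b m 2 ![C₁, C₂] k → k ≠ 0 →
          2 * m - t < mu2 b (k 0) + mu2 b (k 1)) →
        LpDisc p (netPts2 b m C₁ C₂) ≤ C * Real.sqrt (m : ℝ) / (b : ℝ) ^ m := by
  have : Fact b.Prime := ⟨hb⟩
  have hp0 : 0 < p := by linarith
  obtain ⟨A, hA, hexp⟩ := exists_rpow_le_exp p hp0.le
  set L := 2 * A * Real.exp (2 * incrBound b t + incrBound b t ^ 2 / 2) with hL
  have hL0 : 0 < L := by positivity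
  refine ⟨L ^ (1 / p), by positivity, fun m hm ht C₁ C₂ hdual => ?_⟩
  have h := orderTwo_netSeq hdual
  have hbm : (0 : ℝ) < (b : ℝ) ^ m := pow_pos (by exact_mod_cast hb.pos) m
  have hint : ∫ z in Set.Icc ((0 : ℝ), (0 : ℝ)) (1, 1), |disc2 (netPts2 b m C₁ C₂) z| ^ p
      ≤ (√(m : ℝ) / (b : ℝ) ^ m) ^ p * L := by
    refine setIntegral_Icc_prod_le (fun z => by positivity) (by positivity) fun y hy => ?_
    simp only [disc2_netPts2, abs_div, abs_of_pos hbm]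
    simp only [Real.div_rpow (abs_nonneg _) hbm.le, Real.div_rpow (Real.sqrt_nonneg _) hbm.le]
    rw [integral_div, div_mul_eq_mul_div]
    refine div_le_div_of_nonneg_right ?_ (by positivity)
    exact h.setIntegral_scaledDisc_rpow_le hb.one_lt hm ht hy.1 hy.2 hA.le hexp
  have hroot := Real.rpow_le_rpow (integral_nonneg fun z => by positivity) hint
    (show 0 ≤ 1 / p by positivity)
  refine hroot.trans_eq ?_
  rw [Real.mul_rpow (by positivity) hL0.le, ← Real.rpow_mul (by positivity),
    mul_one_div_cancel hp0.ne', Real.rpow_one]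
  ring

end
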